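/- arXiv:1001.0910 — 3 statements merged into one kernel-verified Lean document; each statement's English description precedes it below -/
import Mathlib

section
/- Let d ≥ 1 be an integer, β ∈ (0,2) with β < d, and γ > 0. For every y ∈ ℝ^d with |y| < 1, the Riesz potential of the function y ↦ (1−|y|²)_+^{γ/2} satisfies I_β((1−|·|²)_+^{γ/2})(y) = C_{γ,β,d} · ₂F₁((d−β)/2, −(γ+β)/2; d/2; |y|²), where C_{γ,β,d} = 2^{−β} Γ(γ/2+1) Γ((d−β)/2) / (Γ(d/2) Γ((β+γ)/2+1)). -/
open Real MeasureTheory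

/-- The Riesz potential `I_β(u)(x)` on `ℝ^d`. -/
noncomputable def rieszPotential (d : ℕ) (β : ℝ)
    (u : EuclideanSpace ℝ (Fin d) → ℝ) (x : EuclideanSpace ℝ (Fin d)) : ℝ :=
  (Real.Gamma (((d : ℝ) - β) / 2) /
      (2 ^ β * Real.pi ^ ((d : ℝ) / 2) * Real.Gamma (β / 2))) *
    ∫ z : EuclideanSpace ℝ (Fin d), u z * ‖x - z‖ ^ (β - (d : ℝ))

/-- The Gauss hypergeometric series `₂F₁(a, b; c; z)`. -/
noncomputable def gauss2F1 (a b c z : ℝ) : ℝ :=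
  ∑' n : ℕ,
    ((ascPochhammer ℝ n).eval a * (ascPochhammer ℝ n).eval b /
        ((ascPochhammer ℝ n).eval c * (n.factorial : ℝ))) * z ^ n

/-- The rising factorial `(a)_n`. -/
noncomputable def poch (a : ℝ) (n : ℕ) : ℝ := (ascPochhammer ℝ n).eval a

lemma poch_zero (a : ℝ) : poch a 0 = 1 := by simp [poch]

lemma poch_succ (a : ℝ) (n : ℕ) : poch a (n + 1) = poch a n * (a + n) :=
  ascPochhammer_succ_eval n a

lemma poch_pos {a : ℝ} (ha : 0 < a) (n : ℕ) : 0 < poch a n := ascPochhammer_pos n a ha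

lemma poch_add (a : ℝ) (m n : ℕ) : poch a (m + n) = poch a m * poch (a + m) n := by
  induction n with
  | zero => simp [poch_zero]
  | succ n ih => rw [← add_assoc, poch_succ, ih, poch_succ]; push_cast; ring

lemma Gamma_add_nat {a : ℝ} (ha : 0 < a) (n : ℕ) :
    Real.Gamma (a + n) = poch a n * Real.Gamma a := by
  induction n with
  | zero => simp [poch_zero]
  | succ n ih =>
    rw [Nat.cast_add, Nat.cast_one, ← add_assoc, Real.Gamma_add_one (by positivity), ih, poch_succ]
    ring

lemma poch_two_mul (a : ℝ) (k : ℕ) :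
    poch a (2 * k) = 4 ^ k * poch (a / 2) k * poch ((a + 1) / 2) k := by
  induction k with
  | zero => simp [poch_zero]
  | succ k ih =>
    rw [show 2 * (k + 1) = 2 * k + 1 + 1 by ring, poch_succ, poch_succ, ih, poch_succ, poch_succ]
    push_cast; ring

lemma factorial_two_mul (k : ℕ) :
    ((2 * k).factorial : ℝ) = 4 ^ k * k.factorial * poch (1 / 2) k := by
  induction k with
  | zero => simp [poch_zero]
  | succ k ih =>
    rw [show 2 * (k + 1) = 2 * k + 1 + 1 by ring, Nat.factorial_succ, Nat.factorial_succ,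
      Nat.factorial_succ, poch_succ]
    push_cast; rw [ih]; ring

/-- `(-1)^m (c + k)_m = (1 - c - (k + m))_m`. -/
lemma poch_reflect (c : ℝ) (m : ℕ) : poch (1 - c - m) m = (-1) ^ m * poch c m := by
  induction m with
  | zero => simp [poch_zero]
  | succ m ih =>
    have := poch_add (1 - c - (m + 1 : ℕ)) 1 m
    rw [add_comm 1 m] at this
    rw [this, show poch (1 - c - (m + 1 : ℕ)) 1 = 1 - c - (m + 1 : ℕ) by simp [poch], poch_succ]
    push_cast
    rw [show 1 - c - (m + 1) + 1 = 1 - c - (m : ℝ) by ring, ih]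
    ring

/-- The Chu–Vandermonde identity for rising factorials. -/
lemma sum_antidiagonal_poch_mul_poch (x y : ℝ) (n : ℕ) :
    ∑ p ∈ Finset.HasAntidiagonal.antidiagonal n,
      poch x p.1 / p.1.factorial * (poch y p.2 / p.2.factorial) = poch (x + y) n / n.factorial := by
  induction n with
  | zero => simp [poch_zero]
  | succ n ih =>
    have hf (m : ℕ) : (m.factorial : ℝ) ≠ 0 := by positivity
    have key : ((n : ℝ) + 1) * ∑ p ∈ Finset.HasAntidiagonal.antidiagonal (n + 1),
        poch x p.1 / p.1.factorial * (poch y p.2 / p.2.factorial) =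
        (x + y + n) * ∑ p ∈ Finset.HasAntidiagonal.antidiagonal n,
        poch x p.1 / p.1.factorial * (poch y p.2 / p.2.factorial) := by
      have e1 : ((n : ℝ) + 1) * ∑ p ∈ Finset.HasAntidiagonal.antidiagonal (n + 1),
          poch x p.1 / p.1.factorial * (poch y p.2 / p.2.factorial) =
          ∑ p ∈ Finset.HasAntidiagonal.antidiagonal (n + 1),
            p.1 * (poch x p.1 / p.1.factorial * (poch y p.2 / p.2.factorial)) +
          ∑ p ∈ Finset.HasAntidiagonal.antidiagonal (n + 1),
            p.2 * (poch x p.1 / p.1.factorial * (poch y p.2 / p.2.factorial)) := by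
        rw [Finset.mul_sum, ← Finset.sum_add_distrib]
        refine Finset.sum_congr rfl fun p hp => ?_
        have : (p.1 : ℝ) + p.2 = n + 1 := by exact_mod_cast Finset.HasAntidiagonal.mem_antidiagonal.mp hp
        rw [← this]; ring
      rw [e1, Finset.Nat.sum_antidiagonal_succ, Finset.Nat.sum_antidiagonal_succ']
      simp only [Nat.cast_zero, zero_mul, zero_add]
      rw [← Finset.sum_add_distrib, Finset.mul_sum]
      refine Finset.sum_congr rfl fun p hp => ?_
      have : (n : ℝ) = (p.1 : ℝ) + p.2 := by
        exact_mod_cast (Finset.HasAntidiagonal.mem_antidiagonal.mp hp).symm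
      rw [this, poch_succ, poch_succ, Nat.factorial_succ, Nat.factorial_succ]
      push_cast
      have := hf p.1; have := hf p.2
      field_simp
      ring
    rw [ih] at key
    rw [poch_succ, Nat.factorial_succ]
    push_cast
    have := hf n
    field_simp at key ⊢
    linarith

/-- The Pfaff–Saalschütz identity. -/
lemma pfaff_saalschutz (a b : ℝ) {c : ℝ} (hc : 0 < c) (n : ℕ) :
    ∑ p ∈ Finset.HasAntidiagonal.antidiagonal n, poch a p.1 * poch b p.1 / (poch c p.1 * p.1.factorial) *
      (poch (c - a - b) p.2 / p.2.factorial) =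
    poch (c - a) n * poch (c - b) n / (poch c n * n.factorial) := by
  have hf (m : ℕ) : (m.factorial : ℝ) ≠ 0 := by positivity
  have hp (m : ℕ) : poch c m ≠ 0 := (poch_pos hc m).ne'
  have hcm (m : ℕ) : c + m ≠ 0 := by positivity
  induction n with
  | zero => simp [poch_zero]
  | succ n ih =>
    set T : ℕ × ℕ → ℝ := fun p => poch a p.1 * poch b p.1 / (poch c p.1 * p.1.factorial) *
      (poch (c - a - b) p.2 / p.2.factorial) with hT
    have key : ((n : ℝ) + 1) * (c + n) * ∑ p ∈ Finset.HasAntidiagonal.antidiagonal (n + 1), T p =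
        (c - a + n) * (c - b + n) * ∑ p ∈ Finset.HasAntidiagonal.antidiagonal n, T p := by
      have e1 : ((n : ℝ) + 1) * (c + n) * ∑ p ∈ Finset.HasAntidiagonal.antidiagonal (n + 1), T p =
          ∑ p ∈ Finset.HasAntidiagonal.antidiagonal (n + 1), p.1 * (c + p.1 - 1) * T p +
          ∑ p ∈ Finset.HasAntidiagonal.antidiagonal (n + 1), p.2 * (c + 2 * p.1 + p.2 - 1) * T p := by
        rw [Finset.mul_sum, ← Finset.sum_add_distrib]
        refine Finset.sum_congr rfl fun p hp => ?_
        have : (n : ℝ) = (p.1 : ℝ) + p.2 - 1 := by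
          rw [eq_sub_iff_add_eq]; exact_mod_cast (Finset.HasAntidiagonal.mem_antidiagonal.mp hp).symm
        rw [this]; ring
      rw [e1, Finset.Nat.sum_antidiagonal_succ, Finset.Nat.sum_antidiagonal_succ']
      simp only [Nat.cast_zero, zero_mul, zero_add, add_zero]
      rw [← Finset.sum_add_distrib, Finset.mul_sum]
      refine Finset.sum_congr rfl fun p hp' => ?_
      have : (n : ℝ) = (p.1 : ℝ) + p.2 := by
        exact_mod_cast (Finset.HasAntidiagonal.mem_antidiagonal.mp hp').symm
      simp only [hT]
      rw [this, poch_succ, poch_succ, poch_succ, poch_succ, Nat.factorial_succ, Nat.factorial_succ]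
      push_cast
      have := hf p.1; have := hf p.2; have := hp p.1; have := hcm p.1
      field_simp
      ring
    rw [ih] at key
    rw [poch_succ, poch_succ, poch_succ, Nat.factorial_succ]
    push_cast
    have := hf n; have := hp n; have := hcm n
    field_simp at key ⊢
    linarith

/-- The coefficient identity behind the quadratic transformation of `₂F₁`. -/
lemma sum_antidiagonal_quadratic (l : ℝ) {c : ℝ} (hc : 0 < c) (n : ℕ) :
    ∑ p ∈ Finset.HasAntidiagonal.antidiagonal n, poch l (2 * p.1) / (poch c p.1 * p.1.factorial) *
      ((-1) ^ p.2 * poch (l + 2 * p.1) p.2 / p.2.factorial) =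
    poch l n * poch (l + 1 - c) n / (poch c n * n.factorial) := by
  have hf (m : ℕ) : (m.factorial : ℝ) ≠ 0 := by positivity
  have hp (m : ℕ) : poch c m ≠ 0 := (poch_pos hc m).ne'
  have h := sum_antidiagonal_poch_mul_poch (l + n) (1 - c - n) n
  rw [show l + n + (1 - c - n) = l + 1 - c by ring] at h
  rw [mul_div_mul_comm, ← h, Finset.mul_sum]
  refine Finset.sum_congr rfl fun p hp' => ?_
  obtain ⟨k, m⟩ := p
  obtain rfl : k + m = n := Finset.HasAntidiagonal.mem_antidiagonal.mp hp'
  have h1 : poch l (2 * k) * poch (l + 2 * k) m = poch l (k + m) * poch (l + (k + m : ℕ)) k := by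
    rw [← poch_add, show k + m + k = 2 * k + m by ring, poch_add]; push_cast; rfl
  have h2 : poch (1 - c - (k + m : ℕ)) m = (-1) ^ m * poch (c + k) m := by
    rw [← poch_reflect]; push_cast; congr 1; ring
  have h3 := poch_add c k m
  have := hp k
  have h4 : poch (c + k) m ≠ 0 := (poch_pos (by positivity) m).ne'
  simp only
  rw [h2, h3]
  have := hf k; have := hf m
  field_simp
  linear_combination h1

/-- The coefficients of the Gauss hypergeometric series. -/
noncomputable def hyp (a b c : ℝ) (n : ℕ) : ℝ := poch a n * poch b n / (poch c n * n.factorial)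

lemma hyp_pos {a b c : ℝ} (ha : 0 < a) (hb : 0 < b) (hc : 0 < c) (n : ℕ) : 0 < hyp a b c n :=
  div_pos (mul_pos (poch_pos ha n) (poch_pos hb n)) (mul_pos (poch_pos hc n) (by positivity))

lemma hasSum_binomial_and_summable (s : ℝ) {x : ℝ} (hx : |x| < 1) :
    HasSum (fun n => poch s n / n.factorial * x ^ n) ((1 - x) ^ (-s)) ∧
    Summable (fun n => ‖poch s n / n.factorial * x ^ n‖) := by
  have h := Real.one_div_one_sub_rpow_hasFPowerSeriesOnBall_zero s
  have hmem : x ∈ Metric.eball (0 : ℝ) 1 := by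
    simpa [enorm_eq_nnnorm, ← NNReal.coe_lt_coe] using hx
  have hcoef (n : ℕ) : Ring.choose (s + n - 1) n = poch s n / n.factorial := by
    rw [Ring.choose, eq_div_iff (by positivity), mul_comm, ← nsmul_eq_mul,
      show s + n - 1 - n + 1 = s by ring, Ring.factorial_nsmul_multichoose_eq_ascPochhammer,
      poch, Polynomial.ascPochhammer_smeval_eq_eval]
  have hp (n : ℕ) : (FormalMultilinearSeries.ofScalars ℝ (fun n : ℕ => Ring.choose (s + n - 1) n) :
      FormalMultilinearSeries ℝ ℝ ℝ) n (fun _ => x) = poch s n / n.factorial * x ^ n := by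
    rw [FormalMultilinearSeries.ofScalars_apply_eq, hcoef, smul_eq_mul]
  constructor
  · have := h.hasSum hmem
    simp only [hp, zero_add] at this
    rwa [one_div, ← Real.rpow_neg (by linarith [(abs_lt.mp hx).2])] at this
  · have := FormalMultilinearSeries.summable_norm_apply _
      (Metric.eball_subset_eball h.r_le hmem)
    simpa only [hp] using this

lemma hyp_radius {a b c : ℝ} (ha : 0 < a) (hb : 0 < b) (hc : 0 < c) :
    (ordinaryHypergeometricSeries ℝ a b c).radius = 1 := by
  apply ordinaryHypergeometricSeries_radius_eq_one
  intro n
  have : (0 : ℝ) ≤ n := n.cast_nonneg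
  refine ⟨?_, ?_, ?_⟩ <;> linarith

lemma hypSeries_apply (a b c x : ℝ) (n : ℕ) :
    ordinaryHypergeometricSeries ℝ a b c n (fun _ => x) = hyp a b c n * x ^ n := by
  rw [ordinaryHypergeometricSeries_apply_eq, smul_eq_mul, hyp, poch, poch, poch]
  field_simp

lemma mem_eball_one {x : ℝ} : x ∈ Metric.eball (0 : ℝ) 1 ↔ |x| < 1 := by
  simp [enorm_eq_nnnorm, ← NNReal.coe_lt_coe]

lemma summable_hyp {a b c x : ℝ} (ha : 0 < a) (hb : 0 < b) (hc : 0 < c) (hx : |x| < 1) :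
    Summable (fun n => ‖hyp a b c n * x ^ n‖) := by
  have := FormalMultilinearSeries.summable_norm_apply (ordinaryHypergeometricSeries ℝ a b c)
    (x := x) (by rwa [hyp_radius ha hb hc, mem_eball_one])
  simpa only [hypSeries_apply] using this

lemma analyticOnNhd_hyp {a b c : ℝ} (ha : 0 < a) (hb : 0 < b) (hc : 0 < c) :
    AnalyticOnNhd ℝ (fun x => ∑' n, hyp a b c n * x ^ n) {x | |x| < 1} := by
  have h := (ordinaryHypergeometricSeries ℝ a b c).hasFPowerSeriesOnBall
    (by rw [hyp_radius ha hb hc]; exact one_pos)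
  have h2 := h.analyticOnNhd
  rw [hyp_radius ha hb hc] at h2
  intro x hx
  have := h2 x (mem_eball_one.mpr hx)
  convert this using 1
  ext x
  simp only [FormalMultilinearSeries.sum, hypSeries_apply]

/-- Euler's transformation of `₂F₁`. -/
lemma euler_transformation {a b c x : ℝ} (ha : 0 < a) (hb : 0 < b) (hc : 0 < c) (hx : |x| < 1) :
    (1 - x) ^ (a + b - c) * ∑' n, hyp a b c n * x ^ n = gauss2F1 (c - b) (c - a) c x := by
  obtain ⟨h1, h2⟩ := hasSum_binomial_and_summable (c - a - b) hx
  rw [show a + b - c = -(c - a - b) by ring, ← h1.tsum_eq, mul_comm,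
    tsum_mul_tsum_eq_tsum_sum_antidiagonal_of_summable_norm (summable_hyp ha hb hc hx) h2, gauss2F1]
  refine tsum_congr fun n => ?_
  have := pfaff_saalschutz a b hc n
  rw [poch, poch, poch, mul_comm ((ascPochhammer ℝ n).eval _)] at this
  rw [← this, Finset.sum_mul]
  refine Finset.sum_congr rfl fun p hp => ?_
  rw [← Finset.HasAntidiagonal.mem_antidiagonal.mp hp, pow_add, hyp]
  ring

/-- The coefficients of the even part of a binomial series averaged over a sphere. -/
noncomputable def quad (l c : ℝ) (k : ℕ) : ℝ := poch l (2 * k) / (poch c k * k.factorial)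

lemma quad_eq_hyp (l c : ℝ) (k : ℕ) : quad l c k = 4 ^ k * hyp (l / 2) ((l + 1) / 2) c k := by
  rw [quad, hyp, poch_two_mul]; ring

lemma quad_pos {l c : ℝ} (hl : 0 < l) (hc : 0 < c) (k : ℕ) : 0 < quad l c k :=
  div_pos (poch_pos hl _) (mul_pos (poch_pos hc k) (by positivity))

lemma summable_quad {l c x : ℝ} (hl : 0 < l) (hc : 0 < c) (hx : |4 * x| < 1) :
    Summable (fun k => ‖quad l c k * x ^ k‖) := by
  have := summable_hyp (a := l / 2) (b := (l + 1) / 2) (c := c) (by positivity) (by positivity)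
    hc hx
  simpa only [quad_eq_hyp, mul_pow, mul_comm, mul_left_comm] using this

lemma pow_mul_rpow_neg {s : ℝ} (hs : 0 < s) (l q : ℝ) (k : ℕ) :
    (q / s ^ 2) ^ k * s ^ (-l) = q ^ k * s ^ (-(l + 2 * k)) := by
  rw [neg_add, Real.rpow_add hs, Real.rpow_neg hs.le (2 * k), Real.rpow_mul hs.le,
    Real.rpow_natCast, div_pow]
  norm_num
  ring

lemma quadratic_transformation_of_small {l c q : ℝ} (hl : 0 < l) (hc : 0 < c) (hq : 0 < q)
    (hq' : q < 1 / 10) :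
    (∑' k, quad l c k * (q / (1 + q) ^ 2) ^ k) * (1 + q) ^ (-l) =
      ∑' n, hyp l (l + 1 - c) c n * q ^ n := by
  set f : ℕ × ℕ → ℝ := fun p =>
    quad l c p.1 * q ^ p.1 * (poch (l + 2 * p.1) p.2 / p.2.factorial * (-q) ^ p.2) with hf
  have hnorm : Summable fun p => ‖f p‖ := by
    rw [summable_prod_of_nonneg (fun _ => norm_nonneg _)]
    have hin (k : ℕ) : HasSum (fun m => ‖f (k, m)‖)
        (quad l c k * q ^ k * (1 - q) ^ (-(l + 2 * k))) := by
      have := (hasSum_binomial_and_summable (l + 2 * k) (x := q)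
        (by rw [abs_of_pos hq]; linarith)).1.mul_left (quad l c k * q ^ k)
      refine (congrArg (HasSum · _) (funext fun m => ?_)).mpr this
      have h1 := quad_pos hl hc k
      have h2 : 0 < poch (l + 2 * k) m := poch_pos (by positivity) m
      simp only [hf, norm_mul, norm_div, norm_pow, norm_neg, Real.norm_of_nonneg hq.le,
        Real.norm_of_nonneg h1.le, Real.norm_of_nonneg h2.le, Real.norm_natCast]
    refine ⟨fun k => (hin k).summable, ?_⟩
    simp_rw [fun k => (hin k).tsum_eq, mul_assoc, ← pow_mul_rpow_neg (show 0 < 1 - q by linarith),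
      ← mul_assoc]
    refine Summable.mul_right _ (summable_quad hl hc ?_).of_norm
    rw [abs_of_pos (mul_pos four_pos (div_pos hq (pow_pos (by linarith) 2))), ← mul_div_assoc,
      div_lt_one (pow_pos (by linarith) 2)]
    nlinarith
  have hsum := hnorm.of_norm
  have h1 : ∑' p, f p = (∑' k, quad l c k * (q / (1 + q) ^ 2) ^ k) * (1 + q) ^ (-l) := by
    rw [hsum.tsum_prod, ← tsum_mul_right]
    refine tsum_congr fun k => ?_
    simp only [hf]
    rw [tsum_mul_left, (hasSum_binomial_and_summable (l + 2 * k) (x := -q)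
      (by rw [abs_neg, abs_of_pos hq]; linarith)).1.tsum_eq, sub_neg_eq_add, mul_assoc, mul_assoc,
      pow_mul_rpow_neg (by linarith)]
  have h2 : ∑' p, f p = ∑' n, ∑ p ∈ Finset.HasAntidiagonal.antidiagonal n, f p := by
    rw [← Finset.HasAntidiagonal.sigmaAntidiagonalEquivProd.tsum_eq f]
    conv_rhs => congr; ext; rw [← Finset.sum_finset_coe, ← tsum_fintype (L := .unconditional _)]
    exact (Finset.HasAntidiagonal.sigmaAntidiagonalEquivProd.summable_iff.mpr hsum).tsum_sigma'
      fun n => (hasSum_fintype _).summable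
  rw [← h1, h2]
  refine tsum_congr fun n => ?_
  rw [hyp, ← sum_antidiagonal_quadratic l hc n, Finset.sum_mul]
  refine Finset.sum_congr rfl fun p hp => ?_
  rw [← Finset.HasAntidiagonal.mem_antidiagonal.mp hp, pow_add, neg_pow]
  simp only [hf, quad, neg_pow q]
  ring

lemma abs_four_mul_div_lt_one {q : ℝ} (hq : 0 ≤ q) (hq' : q < 1) :
    |4 * (q / (1 + q) ^ 2)| < 1 := by
  rw [abs_of_nonneg (by positivity), ← mul_div_assoc, div_lt_one (by positivity)]
  nlinarith [mul_pos (sub_pos.mpr hq') (sub_pos.mpr hq')]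

/-- A quadratic transformation of `₂F₁`. -/
lemma quadratic_transformation {l c q : ℝ} (hl : 0 < l) (hc : 0 < c) (hlc : 0 < l + 1 - c)
    (hq : 0 ≤ q) (hq' : q < 1) :
    (∑' k, quad l c k * (q / (1 + q) ^ 2) ^ k) * (1 + q) ^ (-l) =
      ∑' n, hyp l (l + 1 - c) c n * q ^ n := by
  rcases hq.eq_or_lt with rfl | hq
  · rw [tsum_eq_single 0 (by intro n hn; simp [hn]), tsum_eq_single 0 (by intro n hn; simp [hn])]
    simp [quad, hyp, poch_zero]
  have hF : AnalyticOnNhd ℝ (fun q : ℝ =>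
      (∑' k, quad l c k * (q / (1 + q) ^ 2) ^ k) * (1 + q) ^ (-l)) (Set.Ioo 0 1) := by
    intro x hx
    have hx1 : 0 < 1 + x := by linarith [hx.1]
    have e : (fun q : ℝ => ∑' k, quad l c k * (q / (1 + q) ^ 2) ^ k) =
        (fun t => ∑' k, hyp (l / 2) ((l + 1) / 2) c k * t ^ k) ∘
          (fun q : ℝ => 4 * (q / (1 + q) ^ 2)) := by
      ext t
      refine tsum_congr fun k => ?_
      rw [quad_eq_hyp, mul_pow 4]; ring
    refine AnalyticAt.mul ?_ ?_
    · rw [e]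
      refine AnalyticAt.comp (analyticOnNhd_hyp (by positivity) (by positivity) hc _
        (abs_four_mul_div_lt_one hx.1.le hx.2)) ?_
      have : (1 + x) ^ 2 ≠ 0 := by positivity
      fun_prop (disch := assumption)
    · exact ((contDiffAt_const.add contDiffAt_id).rpow_const_of_ne hx1.ne').analyticAt
  have hG : AnalyticOnNhd ℝ (fun q : ℝ => ∑' n, hyp l (l + 1 - c) c n * q ^ n) (Set.Ioo 0 1) :=
    (analyticOnNhd_hyp hl hlc hc).mono fun x hx => by
      rw [Set.mem_ofPred_eq, abs_of_pos hx.1]; exact hx.2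
  refine hF.eqOn_of_preconnected_of_eventuallyEq hG isPreconnected_Ioo (z₀ := 1 / 20)
    (by norm_num) ?_ ⟨hq, hq'⟩
  filter_upwards [Ioo_mem_nhds (show (0 : ℝ) < 1 / 20 by norm_num)
    (show (1 / 20 : ℝ) < 1 / 10 by norm_num)] with x hx
  exact quadratic_transformation_of_small hl hc hx.1 hx.2

/-- The even part of the binomial series. -/
lemma hasSum_even_binomial (l : ℝ) {x : ℝ} (hx : |x| < 1) :
    HasSum (fun k => poch l (2 * k) / (2 * k).factorial * x ^ (2 * k))
      (((1 - x) ^ (-l) + (1 + x) ^ (-l)) / 2) := by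
  have h1 := hasSum_binomial_and_summable l hx
  have h2 := (hasSum_binomial_and_summable l (x := -x) (by rwa [abs_neg])).1
  rw [sub_neg_eq_add] at h2
  have h := (h1.1.add h2).div_const 2
  have hinj : Function.Injective (fun k : ℕ => 2 * k) := fun a b h => by simpa using h
  rw [← hinj.hasSum_iff] at h
  · refine (congrArg (HasSum · _) (funext fun k => ?_)).mpr h
    simp only [Function.comp_apply, (even_two_mul k).neg_pow]
    ring
  · intro n hn
    have : Odd n := by
      rw [← Nat.not_even_iff_odd]
      rintro ⟨k, rfl⟩
      exact hn ⟨k, by simp; ring⟩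
    simp [this.neg_pow]

lemma lintegral_norm_mul_homogeneous {d : ℕ} (hd : 1 ≤ d) {f : ℝ → ENNReal} (hf : Measurable f)
    {h : EuclideanSpace ℝ (Fin d) → ENNReal} (hh : Measurable h) {m : ℕ}
    (hom : ∀ r > 0, ∀ x, h (r • x) = ENNReal.ofReal (r ^ m) * h x) :
    ∫⁻ x, f ‖x‖ * h x =
      (∫⁻ r in Set.Ioi 0, ENNReal.ofReal (r ^ (d - 1)) * (f r * ENNReal.ofReal (r ^ m))) *
        ∫⁻ t : Metric.sphere (0 : EuclideanSpace ℝ (Fin d)) 1,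
          h t ∂(volume : Measure (EuclideanSpace ℝ (Fin d))).toSphere := by
  have : Nonempty (Fin d) := ⟨⟨0, hd⟩⟩
  set μ : Measure (EuclideanSpace ℝ (Fin d)) := volume
  have hmp := (μ.measurePreserving_homeomorphUnitSphereProd).symm
    (homeomorphUnitSphereProd (EuclideanSpace ℝ (Fin d))).toMeasurableEquiv
  have hcoe : ∀ p : Metric.sphere (0 : EuclideanSpace ℝ (Fin d)) 1 × Set.Ioi (0 : ℝ),
      (((homeomorphUnitSphereProd (EuclideanSpace ℝ (Fin d))).toMeasurableEquiv.symm p : _) :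
        EuclideanSpace ℝ (Fin d)) = (p.2 : ℝ) • (p.1 : EuclideanSpace ℝ (Fin d)) := fun p => rfl
  conv_lhs => rw [← restrict_compl_singleton (μ := μ) 0]
  rw [← lintegral_subtype_comap (measurableSet_singleton _).compl,
    ← hmp.lintegral_comp_emb (MeasurableEquiv.measurableEmbedding _)]
  have hpt : ∀ p : Metric.sphere (0 : EuclideanSpace ℝ (Fin d)) 1 × Set.Ioi (0 : ℝ),
      f ‖(p.2 : ℝ) • (p.1 : EuclideanSpace ℝ (Fin d))‖ *
        h ((p.2 : ℝ) • (p.1 : EuclideanSpace ℝ (Fin d))) =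
      h p.1 * (f p.2 * ENNReal.ofReal ((p.2 : ℝ) ^ m)) := fun p => by
    have h2 : 0 < (p.2 : ℝ) := p.2.2
    rw [hom _ h2, norm_smul, norm_eq_of_mem_sphere, Real.norm_of_nonneg h2.le]
    ring_nf
  simp_rw [hcoe, hpt]
  rw [lintegral_prod_mul (f := fun x : Metric.sphere (0 : EuclideanSpace ℝ (Fin d)) 1 =>
      h x)
    (g := fun r : Set.Ioi (0 : ℝ) => f r * ENNReal.ofReal ((r : ℝ) ^ m)) (by fun_prop)
    (by fun_prop), mul_comm]
  congr 1
  rw [Measure.volumeIoiPow, lintegral_withDensity_eq_lintegral_mul _ (by fun_prop) (by fun_prop)]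
  simp only [Pi.mul_apply]
  rw [lintegral_subtype_comap measurableSet_Ioi fun r : ℝ =>
    ENNReal.ofReal (r ^ (Module.finrank ℝ (EuclideanSpace ℝ (Fin d)) - 1)) *
      (f r * ENNReal.ofReal (r ^ m))]
  simp

lemma lintegral_radial {d : ℕ} (hd : 1 ≤ d) {f : ℝ → ENNReal} (hf : Measurable f) :
    ∫⁻ x : EuclideanSpace ℝ (Fin d), f ‖x‖ =
      ENNReal.ofReal (2 * (π ^ ((d : ℝ) / 2) / Gamma ((d : ℝ) / 2))) *
        ∫⁻ r in Set.Ioi 0, ENNReal.ofReal (r ^ (d - 1)) * f r := by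
  have : Nonempty (Fin d) := ⟨⟨0, hd⟩⟩
  have h := lintegral_norm_mul_homogeneous hd hf (h := fun _ => 1) measurable_const (m := 0)
    (by simp)
  simp only [mul_one, pow_zero, ENNReal.ofReal_one, lintegral_const, one_mul] at h
  rw [h, mul_comm, Measure.toSphere_apply_univ, EuclideanSpace.volume_ball]
  congr 1
  have hd' : (0 : ℝ) < d / 2 := by positivity
  simp only [ENNReal.ofReal_one, one_pow, one_mul, finrank_euclideanSpace, Fintype.card_fin]
  rw [← ENNReal.ofReal_natCast, ← ENNReal.ofReal_mul (by positivity), Gamma_add_one hd'.ne',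
    Real.sqrt_eq_rpow, ← Real.rpow_natCast, ← Real.rpow_mul pi_pos.le]
  congr 1
  have := (Gamma_pos_of_pos hd').ne'
  field_simp

lemma integrable_pow_mul_exp_neg_sq (k : ℕ) :
    Integrable fun x : ℝ => x ^ k * exp (-x ^ 2) := by
  have := integrable_rpow_mul_exp_neg_mul_sq (b := 1) one_pos
    (s := (k : ℝ)) (by linarith [Nat.cast_nonneg (α := ℝ) k])
  simpa only [Real.rpow_natCast, neg_mul, one_mul] using this

lemma setIntegral_pow_mul_exp_neg_sq (k : ℕ) :
    ∫ x in Set.Ioi (0 : ℝ), x ^ k * exp (-x ^ 2) = Gamma ((k + 1) / 2) / 2 := by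
  have := integral_rpow_mul_exp_neg_rpow (p := 2) (q := k) two_pos
    (by linarith [Nat.cast_nonneg (α := ℝ) k])
  simp only [Real.rpow_natCast, Real.rpow_two] at this
  rw [this]; ring

lemma integral_pow_mul_exp_neg_sq (k : ℕ) :
    ∫ x : ℝ, x ^ (2 * k) * exp (-x ^ 2) = √π * poch (1 / 2) k := by
  have h := integral_comp_abs (f := fun x : ℝ => x ^ (2 * k) * exp (-x ^ 2))
  simp only [(even_two_mul k).pow_abs, sq_abs] at h
  rw [h, setIntegral_pow_mul_exp_neg_sq, ← Gamma_one_half_eq, mul_comm (Gamma _),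
    ← Gamma_add_nat (by norm_num), mul_div_cancel₀ _ two_ne_zero]
  congr 1
  push_cast
  ring_nf

/-- Gaussian moments in a coordinate direction. -/
lemma lintegral_gaussian_coord {d : ℕ} (i₀ : Fin d) (k : ℕ) :
    ∫⁻ x : EuclideanSpace ℝ (Fin d), ENNReal.ofReal (exp (-‖x‖ ^ 2)) *
        ENNReal.ofReal (x i₀ ^ (2 * k)) =
      ENNReal.ofReal (π ^ ((d : ℝ) / 2) * poch (1 / 2) k) := by
  set e : Fin d → ℕ := fun i => if i = i₀ then k else 0 with he
  have hpt : ∀ x : EuclideanSpace ℝ (Fin d), ENNReal.ofReal (exp (-‖x‖ ^ 2)) *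
      ENNReal.ofReal (x i₀ ^ (2 * k)) =
      ENNReal.ofReal (∏ i, (x i ^ (2 * e i) * exp (-(x i) ^ 2))) := fun x => by
    rw [← ENNReal.ofReal_mul (exp_pos _).le, Finset.prod_mul_distrib, ← Real.exp_sum,
      EuclideanSpace.real_norm_sq_eq, Finset.sum_neg_distrib, mul_comm]
    congr 2
    rw [Finset.prod_eq_single i₀] <;> simp +contextual [he]
  simp_rw [hpt]
  rw [(PiLp.volume_preserving_ofLp (Fin d)).lintegral_comp_emb
    (MeasurableEquiv.toLp 2 (Fin d → ℝ)).symm.measurableEmbedding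
    (fun x : Fin d → ℝ => ENNReal.ofReal (∏ i, (x i ^ (2 * e i) * exp (-(x i) ^ 2)))),
    ← ofReal_integral_eq_lintegral_ofReal]
  · rw [integral_fintype_prod_volume_eq_prod (fun i (t : ℝ) => t ^ (2 * e i) * exp (-t ^ 2))]
    simp_rw [integral_pow_mul_exp_neg_sq]
    rw [Finset.prod_mul_distrib, Finset.prod_const, Finset.card_univ, Fintype.card_fin,
      Real.sqrt_eq_rpow, ← Real.rpow_natCast, ← Real.rpow_mul pi_pos.le, Finset.prod_eq_single i₀]
    · simp only [he, if_true]
      congr 3; ring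
    · intro i _ hi; simp [he, hi, poch_zero]
    · simp
  · exact Integrable.fintype_prod fun i => integrable_pow_mul_exp_neg_sq (2 * e i)
  · refine Filter.Eventually.of_forall fun x => Finset.prod_nonneg fun i _ => ?_
    exact mul_nonneg ((even_two_mul _).pow_nonneg _) (exp_pos _).le

lemma lintegral_gaussian_inner {d : ℕ} (hd : 1 ≤ d) (k : ℕ) (y : EuclideanSpace ℝ (Fin d)) :
    ∫⁻ x : EuclideanSpace ℝ (Fin d), ENNReal.ofReal (exp (-‖x‖ ^ 2)) *
        ENNReal.ofReal (inner ℝ x y ^ (2 * k)) =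
      ENNReal.ofReal (π ^ ((d : ℝ) / 2) * poch (1 / 2) k * (‖y‖ ^ 2) ^ k) := by
  set i₀ : Fin d := ⟨0, hd⟩
  obtain ⟨b, hb⟩ : ∃ b : OrthonormalBasis (Fin d) ℝ (EuclideanSpace ℝ (Fin d)),
      y = ‖y‖ • b i₀ := by
    rcases eq_or_ne y 0 with rfl | hy
    · exact ⟨EuclideanSpace.basisFun _ _, by simp⟩
    · have ho : Orthonormal ℝ (({i₀} : Set (Fin d)).domRestrict fun _ => ‖y‖⁻¹ • y) := by
        refine ⟨fun i => ?_, fun i j hij => (hij (Subsingleton.elim _ _)).elim⟩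
        simp [norm_smul, hy]
      obtain ⟨b, hb⟩ := ho.exists_orthonormalBasis_extension_of_card_eq (by simp)
      exact ⟨b, by rw [hb i₀ rfl, smul_inv_smul₀ (norm_ne_zero_iff.mpr hy)]⟩
  have hpt : ∀ x : EuclideanSpace ℝ (Fin d), ENNReal.ofReal (exp (-‖x‖ ^ 2)) *
      ENNReal.ofReal (inner ℝ x y ^ (2 * k)) =
      ENNReal.ofReal ((‖y‖ ^ 2) ^ k) * (ENNReal.ofReal (exp (-‖b.repr x‖ ^ 2)) *
        ENNReal.ofReal (b.repr x i₀ ^ (2 * k))) := fun x => by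
    have : inner ℝ x y = ‖y‖ * b.repr x i₀ := by
      conv_lhs => rw [hb]
      rw [inner_smul_right, OrthonormalBasis.repr_apply_apply, real_inner_comm]
    rw [this, mul_pow, pow_mul, ENNReal.ofReal_mul (by positivity), LinearIsometryEquiv.norm_map]
    ring
  simp_rw [hpt]
  rw [lintegral_const_mul _ (by fun_prop),
    b.measurePreserving_repr.lintegral_comp (f := fun x => ENNReal.ofReal (exp (-‖x‖ ^ 2)) *
        ENNReal.ofReal (x i₀ ^ (2 * k))) (by fun_prop), lintegral_gaussian_coord,
    ← ENNReal.ofReal_mul (by positivity), mul_comm]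

lemma lintegral_gaussian_norm {d : ℕ} (hd : 1 ≤ d) (k : ℕ) :
    ∫⁻ x : EuclideanSpace ℝ (Fin d), ENNReal.ofReal (exp (-‖x‖ ^ 2)) *
        ENNReal.ofReal (‖x‖ ^ (2 * k)) =
      ENNReal.ofReal (π ^ ((d : ℝ) / 2) * poch ((d : ℝ) / 2) k) := by
  rw [lintegral_radial hd (f := fun r => ENNReal.ofReal (exp (-r ^ 2)) *
    ENNReal.ofReal (r ^ (2 * k))) (by fun_prop)]
  have hpt : ∀ r ∈ Set.Ioi (0 : ℝ), ENNReal.ofReal (r ^ (d - 1)) *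
      (ENNReal.ofReal (exp (-r ^ 2)) * ENNReal.ofReal (r ^ (2 * k))) =
      ENNReal.ofReal (r ^ (2 * k + (d - 1)) * exp (-r ^ 2)) := fun r (hr : 0 < r) => by
    rw [← ENNReal.ofReal_mul (by positivity), ← ENNReal.ofReal_mul (by positivity), pow_add]
    congr 1; ring
  have hd' : (0 : ℝ) < d / 2 := by positivity
  have hG := (Gamma_pos_of_pos hd').ne'
  rw [setLIntegral_congr_fun measurableSet_Ioi hpt, ← ofReal_integral_eq_lintegral_ofReal,
    setIntegral_pow_mul_exp_neg_sq, ← ENNReal.ofReal_mul (by positivity)]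
  · congr 1
    have : ((2 * k + (d - 1) : ℕ) + 1 : ℝ) / 2 = d / 2 + k := by
      push_cast [Nat.cast_sub hd]; ring
    rw [this, Gamma_add_nat hd']
    field_simp
  · exact (integrable_pow_mul_exp_neg_sq _).integrableOn
  · filter_upwards [ae_restrict_mem measurableSet_Ioi] with r (hr : 0 < r)
    positivity

/-- Angular moments: averaging `⟪x, y⟫ ^ (2 * k)` over spheres. -/
lemma lintegral_norm_mul_inner_pow {d : ℕ} (hd : 1 ≤ d) (k : ℕ) (y : EuclideanSpace ℝ (Fin d))
    {f : ℝ → ENNReal} (hf : Measurable f) :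
    ∫⁻ x : EuclideanSpace ℝ (Fin d), f ‖x‖ * ENNReal.ofReal (inner ℝ x y ^ (2 * k)) =
      ENNReal.ofReal (poch (1 / 2) k / poch ((d : ℝ) / 2) k * (‖y‖ ^ 2) ^ k) *
        ∫⁻ x : EuclideanSpace ℝ (Fin d), f ‖x‖ * ENNReal.ofReal (‖x‖ ^ (2 * k)) := by
  have hI := fun {f : ℝ → ENNReal} (hf : Measurable f) =>
    lintegral_norm_mul_homogeneous hd hf (m := 2 * k)
      (h := fun x => ENNReal.ofReal (inner ℝ x y ^ (2 * k))) (by fun_prop) fun r hr x => by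
        rw [real_inner_smul_left, mul_pow, ENNReal.ofReal_mul (by positivity)]
  have hN := fun {f : ℝ → ENNReal} (hf : Measurable f) =>
    lintegral_norm_mul_homogeneous hd hf (m := 2 * k)
      (h := fun x => ENNReal.ofReal (‖x‖ ^ (2 * k))) (by fun_prop) fun r hr x => by
        rw [norm_smul, Real.norm_of_nonneg hr.le, mul_pow, ENNReal.ofReal_mul (by positivity)]
  have hg : Measurable fun r : ℝ => ENNReal.ofReal (exp (-r ^ 2)) := by fun_prop
  have hGI := hI hg
  have hGN := hN hg
  rw [lintegral_gaussian_inner hd] at hGI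
  rw [lintegral_gaussian_norm hd] at hGN
  rw [hI hf, hN hf]
  have hd' : (0 : ℝ) < d / 2 := by positivity
  have hp := poch_pos hd' k
  have hp2 := poch_pos (show (0 : ℝ) < 1 / 2 by norm_num) k
  have hpi : 0 < π ^ ((d : ℝ) / 2) := by positivity
  have hne : ENNReal.ofReal (π ^ ((d : ℝ) / 2) * poch ((d : ℝ) / 2) k) ≠ 0 := by
    rw [Ne, ENNReal.ofReal_eq_zero, not_le]; positivity
  set R := ∫⁻ r in Set.Ioi 0, ENNReal.ofReal (r ^ (d - 1)) *
    (ENNReal.ofReal (exp (-r ^ 2)) * ENNReal.ofReal (r ^ (2 * k)))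
  have hR0 : R ≠ 0 := fun h => hne (by rw [hGN, h, zero_mul])
  rw [mul_left_comm]
  congr 1
  set S := ∫⁻ t : Metric.sphere (0 : EuclideanSpace ℝ (Fin d)) 1, ENNReal.ofReal
    (‖(t : EuclideanSpace ℝ (Fin d))‖ ^ (2 * k))
    ∂(volume : Measure (EuclideanSpace ℝ (Fin d))).toSphere
  have hS0 : S ≠ 0 := fun h => hne (by rw [hGN, h, mul_zero])
  have hRtop : R ≠ ⊤ := fun h => by
    rw [h, ENNReal.top_mul hS0] at hGN; exact ENNReal.ofReal_ne_top hGN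
  rw [← ENNReal.mul_right_inj hR0 hRtop, ← hGI, mul_left_comm, ← hGN,
    ← ENNReal.ofReal_mul (by positivity)]
  congr 1
  field_simp

lemma setLIntegral_Ioi_betaPDF {p q : ℝ} (hp : 0 < p) (hq : 0 < q) :
    ∫⁻ x in Set.Ioi 0, ProbabilityTheory.betaPDF p q x = 1 := by
  have h := lintegral_add_compl (ProbabilityTheory.betaPDF p q) (measurableSet_Ioi (a := 0))
    (μ := volume)
  rwa [ProbabilityTheory.lintegral_betaPDF_eq_one hp hq, Set.compl_Ioi,
    setLIntegral_eq_zero (s := Set.Iic 0) measurableSet_Iic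
      (fun x hx => ProbabilityTheory.betaPDF_eq_zero_of_nonpos hx), add_zero] at h

/-- Radial beta integrals. -/
lemma lintegral_barenblatt_mul_norm_rpow {d : ℕ} (hd : 1 ≤ d) {a p : ℝ} (ha : 0 < a) (hp : 0 < p) :
    ∫⁻ x : EuclideanSpace ℝ (Fin d),
        ENNReal.ofReal ((max (1 - ‖x‖ ^ 2) 0) ^ a * ‖x‖ ^ (p - d)) =
      ENNReal.ofReal (π ^ ((d : ℝ) / 2) / Gamma ((d : ℝ) / 2) *
        (Gamma (p / 2) * Gamma (a + 1) / Gamma (p / 2 + a + 1))) := by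
  rw [lintegral_radial hd (f := fun r => ENNReal.ofReal ((max (1 - r ^ 2) 0) ^ a * r ^ (p - d)))
    (by fun_prop)]
  have hd' : (0 : ℝ) < d / 2 := by positivity
  have hG := Gamma_pos_of_pos hd'
  set B := ProbabilityTheory.beta (p / 2) (a + 1) with hBdef
  have hB : 0 < B := ProbabilityTheory.beta_pos (by positivity) (by positivity)
  have hpt : ∀ r ∈ Set.Ioi (0 : ℝ), ENNReal.ofReal (r ^ (d - 1)) *
      ENNReal.ofReal ((max (1 - r ^ 2) 0) ^ a * r ^ (p - d)) =
      ENNReal.ofReal (B / 2) * (ENNReal.ofReal |2 * r| *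
        ProbabilityTheory.betaPDF (p / 2) (a + 1) (r ^ 2)) := fun r (hr : 0 < r) => by
    rw [abs_of_pos (by positivity)]
    rcases lt_or_ge r 1 with h1 | h1
    · have h2 : 0 < 1 - r ^ 2 := by nlinarith
      rw [ProbabilityTheory.betaPDF_of_pos_lt_one (by positivity) (by linarith), max_eq_left h2.le,
        ← ENNReal.ofReal_mul (by positivity), ← ENNReal.ofReal_mul (by positivity),
        ← ENNReal.ofReal_mul (by positivity), ← hBdef]
      congr 1
      have e : (r ^ 2) ^ (p / 2 - 1) * r = r ^ (d - 1) * r ^ (p - d) := by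
        rw [← Real.rpow_natCast r 2, ← Real.rpow_mul hr.le, ← Real.rpow_natCast r (d - 1),
          ← Real.rpow_add_one hr.ne', ← Real.rpow_add hr]
        congr 1
        push_cast [Nat.cast_sub hd]
        ring
      have e2 : a + 1 - 1 = a := by ring
      rw [e2]
      linear_combination -(1 - r ^ 2) ^ a * e -
        r * (r ^ 2) ^ (p / 2 - 1) * (1 - r ^ 2) ^ a * mul_inv_cancel₀ hB.ne'
    · rw [ProbabilityTheory.betaPDF_eq_zero_of_one_le (by nlinarith),
        max_eq_right (by nlinarith), Real.zero_rpow ha.ne']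
      simp
  have himg : (fun r : ℝ => r ^ 2) '' Set.Ioi 0 = Set.Ioi 0 := by
    ext x
    refine ⟨?_, fun hx => ⟨√x, Real.sqrt_pos.mpr hx, Real.sq_sqrt (le_of_lt hx)⟩⟩
    rintro ⟨r, hr, rfl⟩
    exact pow_pos (Set.mem_Ioi.mp hr) 2
  have hcov := lintegral_image_eq_lintegral_abs_deriv_mul (f := fun r : ℝ => r ^ 2)
    (f' := fun r => 2 * r) measurableSet_Ioi
    (fun x _ => by simpa using (hasDerivAt_pow 2 x).hasDerivWithinAt)
    ((pow_left_strictMonoOn₀ two_ne_zero).injOn.mono fun x (hx : 0 < x) => hx.le)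
    (ProbabilityTheory.betaPDF (p / 2) (a + 1))
  rw [himg, setLIntegral_Ioi_betaPDF (by positivity) (by positivity)] at hcov
  rw [setLIntegral_congr_fun measurableSet_Ioi hpt,
    lintegral_const_mul' _ _ ENNReal.ofReal_ne_top, ← hcov, mul_one,
    ← ENNReal.ofReal_mul (by positivity), hBdef, ProbabilityTheory.beta, ← add_assoc]
  congr 1
  ring

/-- Change of variables under inversion in a sphere. -/
lemma lintegral_comp_inversion {d : ℕ} (C : EuclideanSpace ℝ (Fin d)) {R : ℝ} (hR : R ≠ 0)
    (hd : 1 ≤ d) (g : EuclideanSpace ℝ (Fin d) → ENNReal) :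
    ∫⁻ x, g x = ∫⁻ x, ENNReal.ofReal (((R / dist x C) ^ 2) ^ d) *
      g (EuclideanGeometry.inversion C R x) := by
  have : Nonempty (Fin d) := ⟨⟨0, hd⟩⟩
  have himg : EuclideanGeometry.inversion C R '' {C}ᶜ = {C}ᶜ := by
    rw [Set.image_compl_eq (EuclideanGeometry.inversion_bijective C hR), Set.image_singleton,
      EuclideanGeometry.inversion_self]
  have h := lintegral_image_eq_lintegral_abs_det_fderiv_mul volume
    (measurableSet_singleton C).compl
    (fun x hx => (EuclideanGeometry.hasFDerivAt_inversion (R := R)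
      (by simpa using hx : x ≠ C)).hasFDerivWithinAt)
    (EuclideanGeometry.inversion_injective C hR).injOn g
  rw [himg, restrict_compl_singleton] at h
  rw [h]
  refine lintegral_congr fun x => ?_
  congr 2
  rw [ContinuousLinearMap.det]
  have : ((((R / dist x C) ^ 2) • ((ℝ ∙ (x - C))ᗮ.reflection :
      EuclideanSpace ℝ (Fin d) →L[ℝ] EuclideanSpace ℝ (Fin d)) :
      EuclideanSpace ℝ (Fin d) →L[ℝ] EuclideanSpace ℝ (Fin d)) :
      EuclideanSpace ℝ (Fin d) →ₗ[ℝ] EuclideanSpace ℝ (Fin d)) =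
      ((R / dist x C) ^ 2) • ((ℝ ∙ (x - C))ᗮ.reflection).toLinearMap := rfl
  rw [this, LinearMap.det_smul, Submodule.det_reflection, abs_mul, abs_neg_one_pow, mul_one,
    abs_of_nonneg (by positivity), finrank_euclideanSpace, Fintype.card_fin]

/-- Inversion in the sphere orthogonal to the unit sphere that swaps `0` and `y` moves the
singularity of the Riesz kernel to the origin. -/
lemma lintegral_barenblatt_mul_riesz_kernel {d : ℕ} (hd : 1 ≤ d) {a β : ℝ}
    {y : EuclideanSpace ℝ (Fin d)} (hy : ‖y‖ < 1) :
    ∫⁻ z : EuclideanSpace ℝ (Fin d),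
        ENNReal.ofReal ((max (1 - ‖z‖ ^ 2) 0) ^ a * ‖y - z‖ ^ (β - d)) =
      ENNReal.ofReal ((1 - ‖y‖ ^ 2) ^ (a + β)) * ∫⁻ z : EuclideanSpace ℝ (Fin d),
        ENNReal.ofReal ((max (1 - ‖z‖ ^ 2) 0) ^ a * ‖z‖ ^ (β - d) *
          (1 + ‖z‖ ^ 2 * ‖y‖ ^ 2 - 2 * inner ℝ z y) ^ (-(a + (β + d) / 2))) := by
  rcases eq_or_ne y 0 with rfl | hy0
  · simp
  have : Nonempty (Fin d) := ⟨⟨0, hd⟩⟩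
  set w := ‖y‖ ^ 2 with hw
  have hw0 : 0 < w := by positivity
  have hw1 : 0 < 1 - w := by nlinarith [norm_nonneg y]
  set C := w⁻¹ • y with hC
  set R := √((1 - w) / w)
  have hR : 0 < R := Real.sqrt_pos.mpr (by positivity)
  have hR2 : R ^ 2 = (1 - w) / w := Real.sq_sqrt (by positivity)
  have hCC : ‖C‖ ^ 2 = w⁻¹ := by
    rw [hC, norm_smul, mul_pow, ← hw, Real.norm_of_nonneg (by positivity)]
    field_simp
  have hC0 : C ≠ 0 := by rw [← norm_ne_zero_iff, ← sq_pos_iff, hCC]; positivity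
  have hzC (z : EuclideanSpace ℝ (Fin d)) : inner ℝ z y = w * inner ℝ z C := by
    rw [hC, inner_smul_right, mul_inv_cancel_left₀ hw0.ne']
  have hT0 : EuclideanGeometry.inversion C R 0 = y := by
    rw [EuclideanGeometry.inversion, dist_zero_left, div_pow, hR2, hCC, vsub_eq_sub, vadd_eq_add,
      zero_sub, hC, smul_neg, smul_smul, ← sub_eq_neg_add, ← sub_smul]
    have : w⁻¹ - (1 - w) / w / w⁻¹ * w⁻¹ = 1 := by field_simp; ring
    rw [this, one_smul]
  rw [lintegral_comp_inversion C hR.ne' hd, ← lintegral_const_mul' _ _ ENNReal.ofReal_ne_top]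
  refine lintegral_congr_ae ?_
  filter_upwards [(measure_eq_zero_iff_ae_notMem.mp (measure_singleton C) : _)] with z hz
  have hz : z ≠ C := by simpa using hz
  set D := dist z C ^ 2 with hD
  have hD0 : 0 < D := by have := dist_pos.mpr hz; positivity
  have hDz : D = ‖z‖ ^ 2 - 2 * inner ℝ z C + w⁻¹ := by
    rw [hD, dist_eq_norm, norm_sub_sq_real, hCC]
  set K := 1 + ‖z‖ ^ 2 * w - 2 * inner ℝ z y with hK
  have hKD : K = w * D := by
    rw [hK, hDz, hzC]; field_simp; ring
  have hK0 : 0 < K := by rw [hKD]; positivity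
  set s := (1 - w) / K with hs
  have hs0 : 0 < s := by positivity
  have hsD : (R / dist z C) ^ 2 = s := by rw [div_pow, hR2, ← hD, hs, hKD, div_div]
  have h1 : 1 - ‖EuclideanGeometry.inversion C R z‖ ^ 2 = s * (1 - ‖z‖ ^ 2) := by
    rw [EuclideanGeometry.inversion, hsD, vsub_eq_sub, vadd_eq_add, norm_add_sq_real, norm_smul,
      mul_pow, ← dist_eq_norm, ← hD, hCC, real_inner_smul_left, inner_sub_left,
      real_inner_self_eq_norm_sq, hCC, Real.norm_of_nonneg hs0.le]
    have e1 : s * D = (1 - w) / w := by rw [hs, hKD]; field_simp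
    have e2 : 2 * inner ℝ z C = ‖z‖ ^ 2 + w⁻¹ - D := by rw [hDz]; ring
    have e3 : (1 - w) / w = w⁻¹ - 1 := by field_simp
    rw [e3] at e1
    linear_combination (1 - s) * e1 - s * e2
  have h2 : ‖y - EuclideanGeometry.inversion C R z‖ = ‖z‖ * (s * (1 - w)) ^ (1 / 2 : ℝ) := by
    have : ‖y - EuclideanGeometry.inversion C R z‖ ^ 2 = ‖z‖ ^ 2 * (s * (1 - w)) := by
      conv_lhs => rw [← hT0]
      rw [← dist_eq_norm, EuclideanGeometry.dist_inversion_inversion hC0.symm hz, mul_pow, div_pow,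
        mul_pow, dist_zero_left, dist_zero_left, hCC, ← hD, hR2, hs, hKD]
      field_simp
    rw [← Real.sqrt_eq_rpow, ← Real.sqrt_sq (norm_nonneg z), ← Real.sqrt_mul (sq_nonneg _), ← this,
      Real.sqrt_sq (norm_nonneg _)]
  have h3 : max (s * (1 - ‖z‖ ^ 2)) 0 = s * max (1 - ‖z‖ ^ 2) 0 := by
    rw [mul_max_of_nonneg _ _ hs0.le, mul_zero]
  rw [hsD, h1, h2, h3, ← ENNReal.ofReal_mul (by positivity), ← ENNReal.ofReal_mul (by positivity),
    Real.mul_rpow hs0.le (le_max_right _ _), Real.mul_rpow (norm_nonneg _) (by positivity),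
    ← Real.rpow_mul (by positivity), Real.mul_rpow hs0.le hw1.le, ← Real.rpow_natCast]
  congr 1
  have e1 : s ^ (d : ℝ) * s ^ a * s ^ (1 / 2 * (β - d)) = s ^ (a + (β + d) / 2) := by
    rw [← Real.rpow_add hs0, ← Real.rpow_add hs0]; congr 1; ring
  have e2 : s ^ (a + (β + d) / 2) * (1 - w) ^ (1 / 2 * (β - d)) =
      (1 - w) ^ (a + β) * K ^ (-(a + (β + d) / 2)) := by
    rw [hs, Real.div_rpow hw1.le hK0.le, Real.rpow_neg hK0.le, div_mul_eq_mul_div,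
      ← Real.rpow_add hw1, ← div_eq_mul_inv]
    congr 2; ring
  linear_combination ((max (1 - ‖z‖ ^ 2) 0) ^ a * ‖z‖ ^ (β - d)) *
    ((1 - w) ^ (1 / 2 * (β - d)) * e1 + e2)

lemma hasSum_even_kernel (l : ℝ) {q t : ℝ} (hq : 0 ≤ q) (hq' : q < 1) (ht : t ^ 2 ≤ q) :
    HasSum (fun k => (1 + q) ^ (-l) * (poch l (2 * k) / (2 * k).factorial *
        (2 / (1 + q)) ^ (2 * k)) * t ^ (2 * k))
      (((1 + q - 2 * t) ^ (-l) + (1 + q + 2 * t) ^ (-l)) / 2) := by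
  have h1 : 0 < 1 + q := by positivity
  have hx : |2 * t / (1 + q)| < 1 := by
    rw [abs_div, abs_of_pos h1, div_lt_one h1]
    refine abs_lt_of_sq_lt_sq ?_ h1.le
    nlinarith [mul_pos (sub_pos.mpr hq') (sub_pos.mpr hq')]
  have h := (hasSum_even_binomial l hx).mul_left ((1 + q) ^ (-l))
  obtain ⟨hx1, hx2⟩ := abs_lt.mp hx
  rw [← mul_div_assoc, mul_add, ← Real.mul_rpow h1.le (by linarith),
    ← Real.mul_rpow h1.le (by linarith), mul_sub, mul_add, mul_div_cancel₀ _ h1.ne', mul_one] at h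
  refine (congrArg (HasSum · _) (funext fun k => ?_)).mpr h
  rw [mul_div_right_comm, mul_pow]
  ring

lemma lintegral_add_neg {d : ℕ} {F : EuclideanSpace ℝ (Fin d) → ENNReal} (hF : Measurable F) :
    ∫⁻ z, (F z + F (-z)) = 2 * ∫⁻ z, F z := by
  rw [lintegral_add_left hF, (Measure.measurePreserving_neg volume).lintegral_comp hF, two_mul]

/-- The spherical averages of `(1 + |z|²|y|² - 2⟨z, y⟩)^(-l)` are hypergeometric. -/
lemma lintegral_norm_mul_kernel {d : ℕ} (hd : 1 ≤ d) {ρ : ℝ → ℝ} (hρ : Measurable ρ)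
    (hρ0 : ∀ r, 0 ≤ r → 0 ≤ ρ r) (hρ1 : ∀ r, 1 ≤ r → ρ r = 0) {l : ℝ} (hl : 0 < l)
    (hlc : 0 < l + 1 - d / 2) {y : EuclideanSpace ℝ (Fin d)} (hy : ‖y‖ < 1) :
    ∫⁻ z : EuclideanSpace ℝ (Fin d),
        ENNReal.ofReal (ρ ‖z‖ * (1 + ‖z‖ ^ 2 * ‖y‖ ^ 2 - 2 * inner ℝ z y) ^ (-l)) =
      ∫⁻ z : EuclideanSpace ℝ (Fin d),
        ENNReal.ofReal (ρ ‖z‖ * ∑' n, hyp l (l + 1 - d / 2) (d / 2) n *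
          (‖z‖ ^ 2 * ‖y‖ ^ 2) ^ n) := by
  have hc : (0 : ℝ) < d / 2 := by positivity
  set w : ℝ := ‖y‖ ^ 2 with hw
  have hw0 : 0 ≤ w := by positivity
  have hw1 : w ≤ 1 := by nlinarith [norm_nonneg y]
  have hq {z : EuclideanSpace ℝ (Fin d)} (hz : ‖z‖ < 1) : ‖z‖ ^ 2 * w < 1 := by
    nlinarith [norm_nonneg z]
  set A : ℕ → ℝ → ℝ := fun k r => ρ r * ((1 + r ^ 2 * w) ^ (-l) *
    (poch l (2 * k) / (2 * k).factorial * (2 / (1 + r ^ 2 * w)) ^ (2 * k))) with hA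
  have hAm (k : ℕ) : Measurable (A k) := by fun_prop
  have hA0 (k : ℕ) {r : ℝ} (hr : 0 ≤ r) : 0 ≤ A k r := by
    have := (poch_pos hl (2 * k)).le
    have := hρ0 r hr
    positivity
  have h2ofReal (x : ℝ) : 2 * ENNReal.ofReal x = ENNReal.ofReal (2 * x) := by
    rw [ENNReal.ofReal_mul zero_le_two, ENNReal.ofReal_ofNat]
  have hsymm : ∀ z : EuclideanSpace ℝ (Fin d),
      ENNReal.ofReal (ρ ‖z‖ * (1 + ‖z‖ ^ 2 * w - 2 * inner ℝ z y) ^ (-l)) +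
        ENNReal.ofReal (ρ ‖-z‖ * (1 + ‖-z‖ ^ 2 * w - 2 * inner ℝ (-z) y) ^ (-l)) =
      2 * ∑' k, ENNReal.ofReal (A k ‖z‖) * ENNReal.ofReal (inner ℝ z y ^ (2 * k)) := by
    intro z
    rw [norm_neg]
    rcases le_or_gt 1 ‖z‖ with hz | hz
    · simp [hA, hρ1 _ hz]
    have ht : (inner ℝ z y) ^ 2 ≤ ‖z‖ ^ 2 * w := by
      rw [hw, ← mul_pow]
      exact sq_le_sq' (neg_le_of_abs_le (abs_real_inner_le_norm z y)) (real_inner_le_norm z y)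
    have h := (hasSum_even_kernel l (by positivity) (hq hz) ht).mul_left (ρ ‖z‖)
    have hb (s : ℝ) (hs : s ^ 2 ≤ ‖z‖ ^ 2 * w) : 0 ≤ 1 + ‖z‖ ^ 2 * w - 2 * s := by
      nlinarith [sq_nonneg (1 - s)]
    have hρz := hρ0 _ (norm_nonneg z)
    have h1 := Real.rpow_nonneg (hb _ ht) (-l)
    have h2 := Real.rpow_nonneg (hb (-inner ℝ z y) (by rwa [neg_sq])) (-l)
    simp only [← ENNReal.ofReal_mul (hA0 _ (norm_nonneg z))]
    rw [← ENNReal.ofReal_tsum_of_nonneg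
      (fun k => mul_nonneg (hA0 k (norm_nonneg z)) ((even_two_mul k).pow_nonneg _))
      (by simpa only [hA, mul_assoc] using h.summable),
      h2ofReal,
      inner_neg_left, ← ENNReal.ofReal_add (by positivity) (by positivity)]
    congr 1
    have h' := h.tsum_eq
    simp only [hA, mul_assoc] at h' ⊢
    rw [h', mul_neg, sub_neg_eq_add]
    ring
  have hF : Measurable fun z : EuclideanSpace ℝ (Fin d) =>
      ENNReal.ofReal (ρ ‖z‖ * (1 + ‖z‖ ^ 2 * w - 2 * inner ℝ z y) ^ (-l)) := by fun_prop
  have h2 := lintegral_add_neg hF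
  rw [lintegral_congr hsymm, lintegral_const_mul' _ _ ENNReal.ofNat_ne_top] at h2
  rw [← (ENNReal.mul_right_inj two_ne_zero ENNReal.ofNat_ne_top).mp h2,
    lintegral_tsum (fun k => by fun_prop)]
  have hterm (k : ℕ) : ∫⁻ z : EuclideanSpace ℝ (Fin d),
      ENNReal.ofReal (A k ‖z‖) * ENNReal.ofReal (inner ℝ z y ^ (2 * k)) =
      ∫⁻ z : EuclideanSpace ℝ (Fin d), ENNReal.ofReal (ρ ‖z‖ * (quad l (d / 2) k *
        (‖z‖ ^ 2 * w / (1 + ‖z‖ ^ 2 * w) ^ 2) ^ k * (1 + ‖z‖ ^ 2 * w) ^ (-l))) := by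
    rw [lintegral_norm_mul_inner_pow hd k y (f := fun r => ENNReal.ofReal (A k r)) (by fun_prop),
      ← lintegral_const_mul' _ _ ENNReal.ofReal_ne_top]
    refine lintegral_congr fun z => ?_
    have hp1 := poch_pos (a := 1 / 2) (by norm_num) k
    have hp2 := poch_pos hc k
    rw [← ENNReal.ofReal_mul (hA0 k (norm_nonneg z)), ← ENNReal.ofReal_mul (by positivity)]
    congr 1
    simp only [hA, factorial_two_mul, quad, div_pow, mul_pow, ← pow_mul]
    rw [pow_mul 2 2 k, show (2 : ℝ) ^ 2 = 4 by norm_num, pow_mul ‖y‖, ← hw]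
    have : 1 + ‖z‖ ^ 2 * w ≠ 0 := by positivity
    field_simp
  rw [tsum_congr hterm, ← lintegral_tsum (fun k => by unfold quad; fun_prop)]
  refine lintegral_congr fun z => ?_
  rcases le_or_gt 1 ‖z‖ with hz | hz
  · simp [hρ1 _ hz]
  have hqz : 0 ≤ ‖z‖ ^ 2 * w := by positivity
  rw [← quadratic_transformation hl hc hlc hqz (hq hz), ← tsum_mul_right, ← tsum_mul_left]
  refine (ENNReal.ofReal_tsum_of_nonneg (fun k => ?_) ?_).symm
  · have := hρ0 _ (norm_nonneg z)
    have := quad_pos hl hc k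
    positivity
  · exact ((summable_quad hl hc (abs_four_mul_div_lt_one hqz (hq hz))).of_norm.mul_right _).mul_left _

lemma lintegral_barenblatt_mul_tsum_hyp {d : ℕ} (hd : 1 ≤ d) {a β l w : ℝ} (ha : 0 < a)
    (hβ : 0 < β) (hl : 0 < l) (hw : 0 ≤ w) (hw' : w < 1) :
    ∫⁻ z : EuclideanSpace ℝ (Fin d), ENNReal.ofReal ((max (1 - ‖z‖ ^ 2) 0) ^ a * ‖z‖ ^ (β - d) *
        ∑' n, hyp l (β / 2 + a + 1) (d / 2) n * (‖z‖ ^ 2 * w) ^ n) =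
      ENNReal.ofReal (π ^ ((d : ℝ) / 2) / Gamma ((d : ℝ) / 2) *
        (Gamma (β / 2) * Gamma (a + 1) / Gamma (β / 2 + a + 1)) *
          ∑' n, hyp l (β / 2) (d / 2) n * w ^ n) := by
  have : Nonempty (Fin d) := ⟨⟨0, hd⟩⟩
  have hc : (0 : ℝ) < d / 2 := by positivity
  have hb : 0 < β / 2 + a + 1 := by positivity
  have hG1 := Gamma_pos_of_pos hc
  have hG2 := Gamma_pos_of_pos (half_pos hβ)
  have hG3 := Gamma_pos_of_pos hb
  have hG4 : 0 < Gamma (a + 1) := Gamma_pos_of_pos (by positivity)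
  have hexp : ∀ᵐ z : EuclideanSpace ℝ (Fin d),
      ENNReal.ofReal ((max (1 - ‖z‖ ^ 2) 0) ^ a * ‖z‖ ^ (β - d) *
        ∑' n, hyp l (β / 2 + a + 1) (d / 2) n * (‖z‖ ^ 2 * w) ^ n) =
      ∑' n, ENNReal.ofReal (hyp l (β / 2 + a + 1) (d / 2) n * w ^ n) *
        ENNReal.ofReal ((max (1 - ‖z‖ ^ 2) 0) ^ a * ‖z‖ ^ (β + 2 * n - d)) := by
    filter_upwards [Measure.ae_ne volume (0 : EuclideanSpace ℝ (Fin d))] with z hz0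
    rcases le_or_gt 1 ‖z‖ with hz | hz
    · have : max (1 - ‖z‖ ^ 2) 0 = 0 := max_eq_right (by nlinarith)
      simp [this, Real.zero_rpow ha.ne']
    have hz0' : 0 < ‖z‖ := norm_pos_iff.mpr hz0
    have hqw : |‖z‖ ^ 2 * w| < 1 := by
      rw [abs_of_nonneg (by positivity)]
      nlinarith
    have hs := summable_hyp hl hb hc hqw
    rw [← tsum_mul_left, ENNReal.ofReal_tsum_of_nonneg (fun n => ?_) (hs.of_norm.mul_left _)]
    · refine tsum_congr fun n => ?_
      have := hyp_pos hl hb hc n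
      rw [← ENNReal.ofReal_mul (by positivity), show β + 2 * n - d = β - d + (2 * n : ℕ) by
        push_cast; ring, Real.rpow_add_natCast hz0'.ne', pow_mul, mul_pow]
      ring_nf
    · have := hyp_pos hl hb hc n
      positivity
  have hint (n : ℕ) : ∫⁻ z : EuclideanSpace ℝ (Fin d),
      ENNReal.ofReal (hyp l (β / 2 + a + 1) (d / 2) n * w ^ n) *
        ENNReal.ofReal ((max (1 - ‖z‖ ^ 2) 0) ^ a * ‖z‖ ^ (β + 2 * n - d)) =
      ENNReal.ofReal (π ^ ((d : ℝ) / 2) / Gamma ((d : ℝ) / 2) *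
        (Gamma (β / 2) * Gamma (a + 1) / Gamma (β / 2 + a + 1)) *
          (hyp l (β / 2) (d / 2) n * w ^ n)) := by
    have h0 := hyp_pos hl hb hc n
    have h1 := poch_pos hb n
    have h2 := poch_pos hc n
    rw [lintegral_const_mul' _ _ ENNReal.ofReal_ne_top,
      lintegral_barenblatt_mul_norm_rpow hd ha (by positivity), ← ENNReal.ofReal_mul (by positivity),
      show (β + 2 * n) / 2 = β / 2 + n by ring, show β / 2 + n + a + 1 = β / 2 + a + 1 + n by ring,
      Gamma_add_nat (by positivity), Gamma_add_nat hb]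
    congr 1
    unfold hyp
    generalize β / 2 + a + 1 = b at h1 hG3 ⊢
    field_simp
  rw [lintegral_congr_ae hexp, lintegral_tsum (fun n => by fun_prop), tsum_congr hint,
    ← tsum_mul_left]
  refine (ENNReal.ofReal_tsum_of_nonneg (fun n => ?_) ?_).symm
  · have := hyp_pos hl (half_pos hβ) hc n
    positivity
  · exact (summable_hyp hl (half_pos hβ) hc (by rwa [abs_of_nonneg hw])).of_norm.mul_left _

lemma lintegral_barenblatt_mul_riesz_kernel_eq {d : ℕ} (hd : 1 ≤ d) {a β : ℝ} (ha : 0 < a)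
    (hβ : 0 < β) {y : EuclideanSpace ℝ (Fin d)} (hy : ‖y‖ < 1) :
    ∃ v, 0 ≤ v ∧ v = π ^ ((d : ℝ) / 2) / Gamma ((d : ℝ) / 2) *
        (Gamma (β / 2) * Gamma (a + 1) / Gamma (β / 2 + a + 1)) *
          gauss2F1 (((d : ℝ) - β) / 2) (-(2 * a + β) / 2) ((d : ℝ) / 2) (‖y‖ ^ 2) ∧
      ∫⁻ z : EuclideanSpace ℝ (Fin d),
        ENNReal.ofReal ((max (1 - ‖z‖ ^ 2) 0) ^ a * ‖y - z‖ ^ (β - d)) = ENNReal.ofReal v := by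
  have hc : (0 : ℝ) < d / 2 := by positivity
  set l : ℝ := a + (β + d) / 2 with hl
  have hl0 : 0 < l := by positivity
  have hlc : l + 1 - d / 2 = β / 2 + a + 1 := by rw [hl]; ring
  have hy2 : ‖y‖ ^ 2 < 1 := by nlinarith [norm_nonneg y]
  have hE := euler_transformation hl0 (half_pos hβ) hc (x := ‖y‖ ^ 2)
    (by rwa [abs_of_nonneg (by positivity)])
  rw [show l + β / 2 - d / 2 = a + β by rw [hl]; ring, ← sub_div,
    show d / 2 - l = -(2 * a + β) / 2 by rw [hl]; ring] at hE
  refine ⟨_, ?_, rfl, ?_⟩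
  · rw [← hE]
    have h1 : 0 ≤ ∑' n, hyp l (β / 2) (d / 2) n * (‖y‖ ^ 2) ^ n := tsum_nonneg fun n => by
      have := hyp_pos hl0 (half_pos hβ) hc n
      positivity
    have h2 : 0 ≤ (1 - ‖y‖ ^ 2) ^ (a + β) := Real.rpow_nonneg (by linarith) _
    have hG1 := Gamma_pos_of_pos hc
    have hG2 := Gamma_pos_of_pos (half_pos hβ)
    have hG3 : 0 < Gamma (β / 2 + a + 1) := Gamma_pos_of_pos (by positivity)
    have hG4 : 0 < Gamma (a + 1) := Gamma_pos_of_pos (by positivity)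
    positivity
  rw [lintegral_barenblatt_mul_riesz_kernel hd hy,
    lintegral_norm_mul_kernel hd (ρ := fun r => (max (1 - r ^ 2) 0) ^ a * r ^ (β - d))
      (by fun_prop) (fun r hr => by positivity) (fun r hr => ?_) hl0
      (by rw [hlc]; positivity) hy, hlc,
    lintegral_barenblatt_mul_tsum_hyp hd ha hβ hl0 (by positivity) hy2,
    ← ENNReal.ofReal_mul (Real.rpow_nonneg (by linarith) _), ← hE]
  · congr 1
    ring
  · rw [max_eq_right (by nlinarith), Real.zero_rpow ha.ne', zero_mul]

theorem riesz_potential_barenblatt_inside_ball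
    (d : ℕ) (hd : 1 ≤ d) (β γ : ℝ) (hβ : β ∈ Set.Ioo (0 : ℝ) 2) (hβd : β < d)
    (hγ : 0 < γ) (y : EuclideanSpace ℝ (Fin d)) (hy : ‖y‖ < 1) :
    Integrable (fun z : EuclideanSpace ℝ (Fin d) =>
        (max (1 - ‖z‖ ^ 2) 0) ^ (γ / 2) * ‖y - z‖ ^ (β - (d : ℝ))) ∧
    rieszPotential d β (fun z => (max (1 - ‖z‖ ^ 2) 0) ^ (γ / 2)) y =
      (2 ^ (-β) * Real.Gamma (γ / 2 + 1) * Real.Gamma (((d : ℝ) - β) / 2) /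
          (Real.Gamma ((d : ℝ) / 2) * Real.Gamma ((β + γ) / 2 + 1))) *
        gauss2F1 (((d : ℝ) - β) / 2) (-(γ + β) / 2) ((d : ℝ) / 2) (‖y‖ ^ 2) := by
  obtain ⟨v, hv0, hv, hL⟩ := lintegral_barenblatt_mul_riesz_kernel_eq hd (half_pos hγ) hβ.1 hy
  have hnn (z : EuclideanSpace ℝ (Fin d)) :
      0 ≤ (max (1 - ‖z‖ ^ 2) 0) ^ (γ / 2) * ‖y - z‖ ^ (β - (d : ℝ)) := by positivity
  have hm : AEStronglyMeasurable (fun z : EuclideanSpace ℝ (Fin d) =>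
      (max (1 - ‖z‖ ^ 2) 0) ^ (γ / 2) * ‖y - z‖ ^ (β - (d : ℝ))) volume :=
    Measurable.aestronglyMeasurable (by fun_prop)
  refine ⟨⟨hm, ?_⟩, ?_⟩
  · rw [hasFiniteIntegral_iff_ofReal (.of_forall hnn), hL]
    exact ENNReal.ofReal_lt_top
  rw [rieszPotential, integral_eq_lintegral_of_nonneg_ae (.of_forall hnn) hm, hL,
    ENNReal.toReal_ofReal hv0, hv, mul_div_cancel₀ γ two_ne_zero, Real.rpow_neg zero_le_two,
    show β / 2 + γ / 2 + 1 = (β + γ) / 2 + 1 by ring]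
  have hG : 0 < Gamma (β / 2) := Gamma_pos_of_pos (half_pos hβ.1)
  have hπ : 0 < π ^ ((d : ℝ) / 2) := by positivity
  field_simp
end

section
/- Let d ≥ 1 be an integer and α ∈ (0,2) with 2−α < d, and let φ_α(y) = (1−|y|²)_+^{α/2}. Then for every y ∈ ℝ^d with |y| ≤ 1, I_{2−α}(φ_α)(y) = C · (1 − ((d+α−2)/d)|y|²), where C = 2^{α−2} Γ(α/2+1) Γ((d+α)/2 − 1) / Γ(d/2). -/
open Real MeasureTheory

/-- Integration in polar coordinates for nonnegative functions. -/
theorem lintegral_eq_lintegral_toSphere {E : Type*} [NormedAddCommGroup E] [NormedSpace ℝ E]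
    [FiniteDimensional ℝ E] [Nontrivial E] [MeasurableSpace E] [BorelSpace E]
    (μ : Measure E) [μ.IsAddHaarMeasure]
    {f : E → ENNReal} (hf : Measurable f) :
    ∫⁻ x, f x ∂μ = ∫⁻ ω : Metric.sphere (0 : E) 1, (∫⁻ r in Set.Ioi (0 : ℝ),
      ENNReal.ofReal (r ^ (Module.finrank ℝ E - 1)) * f (r • (ω : E))) ∂μ.toSphere := by
  have hpos : ∀ ω : Metric.sphere (0 : E) 1,
      (∫⁻ r in Set.Ioi (0 : ℝ),
        ENNReal.ofReal (r ^ (Module.finrank ℝ E - 1)) * f (r • (ω : E))) =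
      ∫⁻ r : Set.Ioi (0 : ℝ), f ((r : ℝ) • (ω : E))
        ∂Measure.volumeIoiPow (Module.finrank ℝ E - 1) := by
    intro ω
    rw [Measure.volumeIoiPow, lintegral_withDensity_eq_lintegral_mul _ (by fun_prop)
      (by fun_prop), ← lintegral_subtype_comap measurableSet_Ioi]
    rfl
  simp_rw [hpos]
  rw [← lintegral_prod (fun p : Metric.sphere (0 : E) 1 × Set.Ioi (0 : ℝ) =>
      f ((p.2 : ℝ) • (p.1 : E))) (by fun_prop),
    ← (μ.measurePreserving_homeomorphUnitSphereProd).lintegral_comp_emb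
      (Homeomorph.measurableEmbedding _)]
  have h : ∀ x : ({0}ᶜ : Set E), f (((homeomorphUnitSphereProd E x).2 : ℝ) •
      ((homeomorphUnitSphereProd E x).1 : E)) = f x := by
    intro x
    congr 1
    have : (x : E) ≠ 0 := x.2
    simp [smul_smul, this]
  simp_rw [h]
  rw [lintegral_subtype_comap (measurableSet_singleton _).compl, restrict_compl_singleton]

theorem measurable_mul_ite_lt {X : Type*} [MeasurableSpace X] {f : X → ENNReal} {g h : X → ℝ}
    (hf : Measurable f) (hg : Measurable g) (hh : Measurable h) :
    Measurable fun x => f x * if g x < h x then 1 else 0 :=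
  hf.mul (Measurable.ite (measurableSet_lt hg hh) measurable_const measurable_const)

theorem setLIntegral_Ioo_rpow {s M : ℝ} (hs : 0 < s) (hM : 0 ≤ M) :
    ∫⁻ t in Set.Ioo 0 M, ENNReal.ofReal (s * t ^ (s - 1)) = ENNReal.ofReal (M ^ s) := by
  rw [Measure.restrict_congr_set Ioo_ae_eq_Ioc, ← ofReal_integral_eq_lintegral_ofReal,
    ← intervalIntegral.integral_of_le hM, intervalIntegral.integral_const_mul,
    integral_rpow (Or.inl (by linarith))]
  · congr 1
    rw [sub_add_cancel, zero_rpow hs.ne']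
    field_simp
    ring
  · rw [← IntegrableOn, ← intervalIntegrable_iff_integrableOn_Ioc_of_le hM]
    exact (intervalIntegral.intervalIntegrable_rpow' (by linarith)).const_mul _
  · filter_upwards [ae_restrict_mem measurableSet_Ioc] with t ht
    have := ht.1
    positivity

theorem setLIntegral_Ioi_rpow_ite {s : ℝ} (hs : 0 < s) (X : ℝ) (p : ℝ → Prop) [DecidablePred p]
    (hp : ∀ t, 0 < t → (p t ↔ t < X)) :
    ∫⁻ t in Set.Ioi 0, (ENNReal.ofReal (s * t ^ (s - 1)) * if p t then 1 else 0) =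
      ENNReal.ofReal (max X 0 ^ s) := by
  rw [← setLIntegral_Ioo_rpow hs (le_max_right X 0),
    ← lintegral_indicator measurableSet_Ioi, ← lintegral_indicator measurableSet_Ioo]
  refine lintegral_congr fun t => ?_
  by_cases ht : 0 < t
  · by_cases h : t < X <;> simp [Set.indicator, ht, hp t ht, h, ht.le]
  · simp [Set.indicator, ht]

theorem lintegral_rpow_mul_exp_neg_mul {s x : ℝ} (hs : 0 < s) (hx : 0 < x) :
    ∫⁻ t in Set.Ioi 0, ENNReal.ofReal (t ^ (s - 1) * Real.exp (-(x * t))) =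
      ENNReal.ofReal ((1 / x) ^ s * Real.Gamma s) := by
  rw [← Real.integral_rpow_mul_exp_neg_mul_Ioi hs hx, ofReal_integral_eq_lintegral_ofReal]
  · apply Integrable.of_integral_ne_zero
    rw [Real.integral_rpow_mul_exp_neg_mul_Ioi hs hx]
    have := Real.Gamma_pos_of_pos hs
    positivity
  · filter_upwards [ae_restrict_mem measurableSet_Ioi] with t ht
    have : (0 : ℝ) < t := ht
    positivity

/-- The Beta integral over the half-line. -/
theorem lintegral_rpow_mul_one_add_rpow {s k : ℝ} (hs : 0 < s) (hsk : s < k) :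
    ∫⁻ t in Set.Ioi 0, ENNReal.ofReal (t ^ (s - 1) * (1 / (1 + t)) ^ k) =
      ENNReal.ofReal (Real.Gamma s * Real.Gamma (k - s) / Real.Gamma k) := by
  have hk : 0 < k := hs.trans hsk
  have hΓ := Real.Gamma_pos_of_pos hk
  have h1 : ∀ t ∈ Set.Ioi (0 : ℝ), ENNReal.ofReal (t ^ (s - 1) * (1 / (1 + t)) ^ k) =
      ∫⁻ x in Set.Ioi (0 : ℝ), ENNReal.ofReal (1 / Real.Gamma k) *
        (ENNReal.ofReal (t ^ (s - 1)) *
          ENNReal.ofReal (x ^ (k - 1) * Real.exp (-((1 + t) * x)))) := by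
    intro t ht
    have ht : 0 < t := ht
    rw [lintegral_const_mul _ (by fun_prop), lintegral_const_mul _ (by fun_prop),
      lintegral_rpow_mul_exp_neg_mul hk (by linarith), ← ENNReal.ofReal_mul (by positivity),
      ← ENNReal.ofReal_mul (by positivity)]
    congr 1
    field_simp
  rw [setLIntegral_congr_fun measurableSet_Ioi h1, lintegral_lintegral_swap (by fun_prop)]
  have h2 : ∀ x ∈ Set.Ioi (0 : ℝ), (∫⁻ t in Set.Ioi (0 : ℝ), ENNReal.ofReal (1 / Real.Gamma k) *
        (ENNReal.ofReal (t ^ (s - 1)) *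
          ENNReal.ofReal (x ^ (k - 1) * Real.exp (-((1 + t) * x))))) =
      ENNReal.ofReal (Real.Gamma s / Real.Gamma k) *
        ENNReal.ofReal (x ^ (k - s - 1) * Real.exp (-(1 * x))) := by
    intro x hx
    have hx : 0 < x := hx
    have hΓs := Real.Gamma_pos_of_pos hs
    have h3 : ∀ t ∈ Set.Ioi (0 : ℝ), ENNReal.ofReal (1 / Real.Gamma k) *
        (ENNReal.ofReal (t ^ (s - 1)) *
          ENNReal.ofReal (x ^ (k - 1) * Real.exp (-((1 + t) * x)))) =
        ENNReal.ofReal (1 / Real.Gamma k * (x ^ (k - 1) * Real.exp (-x))) *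
          ENNReal.ofReal (t ^ (s - 1) * Real.exp (-(x * t))) := by
      intro t ht
      have ht : 0 < t := ht
      rw [← ENNReal.ofReal_mul (by positivity), ← ENNReal.ofReal_mul (by positivity),
        ← ENNReal.ofReal_mul (by positivity)]
      congr 1
      rw [show -((1 + t) * x) = -x + -(x * t) by ring, Real.exp_add]
      ring
    rw [setLIntegral_congr_fun measurableSet_Ioi h3, lintegral_const_mul _ (by fun_prop),
      lintegral_rpow_mul_exp_neg_mul hs hx, ← ENNReal.ofReal_mul (by positivity),
      ← ENNReal.ofReal_mul (by positivity)]
    have h4 : x ^ (k - s - 1) = x ^ (k - 1) * (x ^ s)⁻¹ := by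
      rw [show k - s - 1 = (k - 1) - s by ring, rpow_sub hx (k - 1) s, div_eq_mul_inv]
    rw [h4, one_div x, inv_rpow hx.le, one_mul]
    congr 1
    ring
  rw [setLIntegral_congr_fun measurableSet_Ioi h2, lintegral_const_mul _ (by fun_prop),
    lintegral_rpow_mul_exp_neg_mul (by linarith) one_pos, ← ENNReal.ofReal_mul (by
      have := Real.Gamma_pos_of_pos hs; positivity)]
  congr 1
  simp
  ring

section InnerProduct

variable {E : Type*} [NormedAddCommGroup E] [InnerProductSpace ℝ E] [FiniteDimensional ℝ E]

theorem lintegral_radial_newtonian {a : ℝ} (ha : 0 ≤ a) [Nontrivial E] (p : E)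
    (ω : Metric.sphere (0 : E) 1) :
    ∫⁻ r in Set.Ioi (0 : ℝ), ENNReal.ofReal (r ^ (Module.finrank ℝ E - 1)) *
      (ENNReal.ofReal (‖r • (ω : E)‖ ^ (2 - Module.finrank ℝ E : ℝ)) *
        if ‖r • (ω : E)‖ ^ 2 + 2 * inner ℝ p (r • (ω : E)) < a then 1 else 0) =
      ENNReal.ofReal (1 / 2 * (√(inner ℝ p (ω : E) ^ 2 + a) - inner ℝ p (ω : E)) ^ 2) := by
  have hd : 0 < Module.finrank ℝ E := Module.finrank_pos
  have hω : ‖(ω : E)‖ = 1 := by simp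
  set b : ℝ := inner ℝ p (ω : E) with hb
  have hsq : |b| ≤ √(b ^ 2 + a) := by
    rw [← Real.sqrt_sq_eq_abs]
    exact Real.sqrt_le_sqrt (by linarith)
  have h1 : ∀ r ∈ Set.Ioi (0 : ℝ), ENNReal.ofReal (r ^ (Module.finrank ℝ E - 1)) *
      (ENNReal.ofReal (‖r • (ω : E)‖ ^ (2 - Module.finrank ℝ E : ℝ)) *
        if ‖r • (ω : E)‖ ^ 2 + 2 * inner ℝ p (r • (ω : E)) < a then 1 else 0) =
      ENNReal.ofReal (1 / 2) * (ENNReal.ofReal (2 * r ^ ((2 : ℝ) - 1)) *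
        if r ^ 2 + 2 * (r * b) < a then 1 else 0) := by
    intro r hr
    have hr : 0 < r := hr
    rw [norm_smul, hω, mul_one, Real.norm_of_nonneg hr.le, ← mul_assoc, ← mul_assoc,
      ← ENNReal.ofReal_mul (by positivity), ← ENNReal.ofReal_mul (by positivity),
      inner_smul_right, ← hb, ← rpow_natCast r (_ - 1), ← rpow_add hr]
    congr 2
    push_cast [Nat.cast_sub hd]
    ring_nf
  rw [setLIntegral_congr_fun measurableSet_Ioi h1, lintegral_const_mul _ (by
      refine measurable_mul_ite_lt ?_ ?_ ?_ <;> fun_prop),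
    setLIntegral_Ioi_rpow_ite two_pos (√(b ^ 2 + a) - b), ← ENNReal.ofReal_mul (by norm_num),
    max_eq_left (by linarith [le_abs_self b]), rpow_two]
  intro r hr
  rw [lt_sub_iff_add_lt]
  constructor
  · intro h
    exact Real.lt_sqrt_of_sq_lt (by linarith)
  · intro h
    have h2 : |r + b| < √(b ^ 2 + a) := abs_lt.2 ⟨by linarith [neg_abs_le b], h⟩
    rw [Real.lt_sqrt (abs_nonneg _), sq_abs] at h2
    linarith

variable [MeasurableSpace E] [BorelSpace E]

theorem lintegral_ball_inner_sq_eq_of_norm_eq {p q : E} (h : ‖p‖ = ‖q‖) :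
    ∫⁻ w : E, (ENNReal.ofReal (inner ℝ p w ^ 2) * if ‖w‖ < 1 then 1 else 0) =
      ∫⁻ w : E, (ENNReal.ofReal (inner ℝ q w ^ 2) * if ‖w‖ < 1 then 1 else 0) := by
  set R : E ≃ₗᵢ[ℝ] E := (ℝ ∙ (p - q))ᗮ.reflection
  have hR : R p = q := Submodule.reflection_sub h
  rw [← R.measurePreserving.lintegral_comp_emb R.toHomeomorph.measurableEmbedding
    (fun w => ENNReal.ofReal (inner ℝ q w ^ 2) * if ‖w‖ < 1 then 1 else 0)]
  refine lintegral_congr fun w => ?_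
  rw [← hR, R.inner_map_map, R.norm_map]

variable [Nontrivial E]

theorem lintegral_ball_inner_sq_eq_toSphere (p : E) :
    ∫⁻ w : E, (ENNReal.ofReal (inner ℝ p w ^ 2) * if ‖w‖ < 1 then 1 else 0) =
      ENNReal.ofReal (1 / (Module.finrank ℝ E + 2)) *
        ∫⁻ ω : Metric.sphere (0 : E) 1, ENNReal.ofReal (inner ℝ p (ω : E) ^ 2)
          ∂(volume : Measure E).toSphere := by
  have hd : 0 < Module.finrank ℝ E := Module.finrank_pos
  rw [lintegral_eq_lintegral_toSphere volume (by
      refine measurable_mul_ite_lt ?_ ?_ ?_ <;> fun_prop),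
    ← lintegral_const_mul _ (by fun_prop)]
  refine lintegral_congr fun ω => ?_
  have hω : ‖(ω : E)‖ = 1 := by simp
  have h1 : ∀ r ∈ Set.Ioi (0 : ℝ), ENNReal.ofReal (r ^ (Module.finrank ℝ E - 1)) *
      (ENNReal.ofReal (inner ℝ p (r • (ω : E)) ^ 2) * if ‖r • (ω : E)‖ < 1 then 1 else 0) =
      ENNReal.ofReal (1 / (Module.finrank ℝ E + 2) * inner ℝ p (ω : E) ^ 2) *
        (ENNReal.ofReal ((Module.finrank ℝ E + 2 : ℝ) *
          r ^ ((Module.finrank ℝ E + 2 : ℝ) - 1)) * if r < 1 then 1 else 0) := by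
    intro r hr
    have hr : 0 < r := hr
    rw [norm_smul, hω, mul_one, Real.norm_of_nonneg hr.le, ← mul_assoc, ← mul_assoc,
      ← ENNReal.ofReal_mul (by positivity), ← ENNReal.ofReal_mul (by positivity)]
    congr 2
    have h2 : r ^ ((Module.finrank ℝ E + 2 : ℝ) - 1) = r ^ (Module.finrank ℝ E - 1) * r ^ 2 := by
      rw [← pow_add, ← rpow_natCast]
      congr 1
      push_cast [Nat.cast_sub hd]
      ring
    rw [h2, inner_smul_right]
    field_simp
  rw [setLIntegral_congr_fun measurableSet_Ioi h1, lintegral_const_mul _ (by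
      refine measurable_mul_ite_lt ?_ ?_ ?_ <;> fun_prop),
    setLIntegral_Ioi_rpow_ite (by positivity) 1 _ (fun t _ => Iff.rfl),
    ENNReal.ofReal_mul (by positivity)]
  simp

/-- The second moment of the surface measure of the unit sphere. -/
theorem lintegral_toSphere_inner_sq (p : E) :
    ∫⁻ ω : Metric.sphere (0 : E) 1, ENNReal.ofReal (inner ℝ p (ω : E) ^ 2)
        ∂(volume : Measure E).toSphere =
      ENNReal.ofReal (‖p‖ ^ 2 / Module.finrank ℝ E) * (volume : Measure E).toSphere Set.univ := by
  have hd : 0 < Module.finrank ℝ E := Module.finrank_pos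
  set M : E → ENNReal := fun p => ∫⁻ ω : Metric.sphere (0 : E) 1,
    ENNReal.ofReal (inner ℝ p (ω : E) ^ 2) ∂(volume : Measure E).toSphere with hM
  have hMeq : ∀ p q : E, ‖p‖ = ‖q‖ → M p = M q := by
    intro p q h
    have := lintegral_ball_inner_sq_eq_of_norm_eq h
    rw [lintegral_ball_inner_sq_eq_toSphere, lintegral_ball_inner_sq_eq_toSphere] at this
    refine (ENNReal.mul_right_inj ?_ ENNReal.ofReal_ne_top).1 this
    rw [Ne, ENNReal.ofReal_eq_zero, not_le]
    positivity
  let e := stdOrthonormalBasis ℝ E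
  have hsum : ∑ i, M (‖p‖ • e i) = ENNReal.ofReal (‖p‖ ^ 2) *
      (volume : Measure E).toSphere Set.univ := by
    simp only [hM]
    rw [← lintegral_finsetSum _ (by fun_prop), ← lintegral_const]
    refine lintegral_congr fun ω => ?_
    rw [← ENNReal.ofReal_sum_of_nonneg (fun _ _ => sq_nonneg _)]
    congr 1
    simp_rw [inner_smul_left, mul_pow, ← Finset.mul_sum]
    rw [e.sum_sq_inner_right]
    simp
  have hconst : ∀ i, M (‖p‖ • e i) = M p := fun i => hMeq _ _ (by simp [norm_smul])
  simp_rw [hconst] at hsum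
  rw [Finset.sum_const, Finset.card_univ, Fintype.card_fin, nsmul_eq_mul] at hsum
  change M p = _
  refine (ENNReal.mul_right_inj (a := (Module.finrank ℝ E : ENNReal)) (by simpa using hd.ne')
    (by simp)).1 ?_
  rw [hsum, ← mul_assoc, ← ENNReal.ofReal_natCast, ← ENNReal.ofReal_mul (by positivity)]
  congr 2
  field_simp

/-- The Newtonian potential of a ball at an interior point: the set `‖w‖ ^ 2 + 2 ⟪p, w⟫ < a` is the
ball of squared radius `a + ‖p‖ ^ 2` centred at `-p`. -/
theorem lintegral_newtonian_ball {a : ℝ} (ha : 0 ≤ a) (p : E) :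
    ∫⁻ w : E, (ENNReal.ofReal (‖w‖ ^ (2 - Module.finrank ℝ E : ℝ)) *
        if ‖w‖ ^ 2 + 2 * inner ℝ p w < a then 1 else 0) =
      ENNReal.ofReal (a / 2 + ‖p‖ ^ 2 / Module.finrank ℝ E) *
        (volume : Measure E).toSphere Set.univ := by
  set I : E → ENNReal := fun p =>
    ∫⁻ w : E, (ENNReal.ofReal (‖w‖ ^ (2 - Module.finrank ℝ E : ℝ)) *
      if ‖w‖ ^ 2 + 2 * inner ℝ p w < a then 1 else 0) with hI
  have hneg : I (-p) = I p := by
    simp only [hI]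
    rw [← lintegral_neg_eq_self]
    simp
  have hpolar : ∀ p, I p = ∫⁻ ω : Metric.sphere (0 : E) 1,
      ENNReal.ofReal (1 / 2 * (√(inner ℝ p (ω : E) ^ 2 + a) - inner ℝ p (ω : E)) ^ 2)
        ∂(volume : Measure E).toSphere := by
    intro p
    simp only [hI]
    rw [lintegral_eq_lintegral_toSphere volume (by
      refine measurable_mul_ite_lt ?_ ?_ ?_ <;> fun_prop)]
    exact lintegral_congr fun ω => lintegral_radial_newtonian ha p ω
  have hsum : 2 * I p = 2 * (ENNReal.ofReal (a / 2 + ‖p‖ ^ 2 / Module.finrank ℝ E) *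
        (volume : Measure E).toSphere Set.univ) := by
    calc 2 * I p = I p + I (-p) := by rw [hneg, two_mul]
      _ = ∫⁻ ω : Metric.sphere (0 : E) 1, (ENNReal.ofReal a +
            2 * ENNReal.ofReal (inner ℝ p (ω : E) ^ 2)) ∂(volume : Measure E).toSphere := by
        rw [hpolar, hpolar, ← lintegral_add_left (by fun_prop)]
        refine lintegral_congr fun ω => ?_
        rw [← ENNReal.ofReal_ofNat 2, ← ENNReal.ofReal_mul (by norm_num),
          ← ENNReal.ofReal_add (by positivity) (by positivity),
          ← ENNReal.ofReal_add (by positivity) (by positivity), inner_neg_left, neg_sq]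
        congr 1
        have := Real.sq_sqrt (show 0 ≤ inner ℝ p (ω : E) ^ 2 + a by positivity)
        linear_combination this
      _ = _ := by
        rw [lintegral_add_left (by fun_prop), lintegral_const_mul _ (by fun_prop),
          lintegral_toSphere_inner_sq, lintegral_const, ← mul_assoc, ← mul_assoc, ← add_mul,
          ← ENNReal.ofReal_ofNat 2, ← ENNReal.ofReal_mul (by norm_num),
          ← ENNReal.ofReal_mul (by norm_num), ← ENNReal.ofReal_add ha (by positivity)]
        congr 2
        ring
  exact (ENNReal.mul_right_inj (by norm_num) (by norm_num)).1 hsum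

/-- Layer-cake decomposition of `X₊ ^ s * ρ ^ (c - 2 * s)` into truncated powers `ρ ^ c`. -/
theorem ofReal_mul_rpow_eq_lintegral {s X ρ : ℝ} (hs : 0 < s) (hρ : 0 < ρ) (c : ℝ) :
    ENNReal.ofReal (max X 0 ^ s * ρ ^ (c - 2 * s)) =
      ∫⁻ t in Set.Ioi 0, (ENNReal.ofReal (s * t ^ (s - 1)) *
        (ENNReal.ofReal (ρ ^ c) * if t * ρ ^ 2 < X then 1 else 0)) := by
  have h : ∀ t : ℝ, (ENNReal.ofReal (s * t ^ (s - 1)) *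
        (ENNReal.ofReal (ρ ^ c) * if t * ρ ^ 2 < X then 1 else 0)) =
      ENNReal.ofReal (ρ ^ c) * (ENNReal.ofReal (s * t ^ (s - 1)) *
        if t * ρ ^ 2 < X then 1 else 0) := fun t => by ring
  simp_rw [h]
  rw [lintegral_const_mul _ (by refine measurable_mul_ite_lt ?_ ?_ ?_ <;> fun_prop),
    setLIntegral_Ioi_rpow_ite hs (X / ρ ^ 2) _ (fun t _ => (lt_div_iff₀ (by positivity)).symm),
    ← ENNReal.ofReal_mul (by positivity)]
  congr 1
  have h1 : max (X / ρ ^ 2) 0 = max X 0 / ρ ^ 2 := by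
    rw [← max_div_div_right (by positivity), zero_div]
  rw [h1, div_rpow (le_max_right _ _) (by positivity), rpow_sub hρ, rpow_mul hρ.le, rpow_two]
  ring

theorem lintegral_riesz_kernel {s : ℝ} (hs : 0 < s) (hs1 : s < 1) {y : E} (hy : ‖y‖ ≤ 1) :
    ∫⁻ z : E, ENNReal.ofReal
        (max (1 - ‖z‖ ^ 2) 0 ^ s * ‖y - z‖ ^ ((2 - Module.finrank ℝ E : ℝ) - 2 * s)) =
      ENNReal.ofReal (s * Real.Gamma s * Real.Gamma (1 - s) / 2 *
          (1 - (Module.finrank ℝ E + 2 * s - 2) / Module.finrank ℝ E * ‖y‖ ^ 2)) *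
        (volume : Measure E).toSphere Set.univ := by
  have hd : 0 < Module.finrank ℝ E := Module.finrank_pos
  have hy2 : 0 ≤ 1 - ‖y‖ ^ 2 := by nlinarith [norm_nonneg y]
  rw [← lintegral_add_left_eq_self _ y]
  have h1 : ∀ᵐ w : E, ENNReal.ofReal (max (1 - ‖y + w‖ ^ 2) 0 ^ s *
      ‖y - (y + w)‖ ^ ((2 - Module.finrank ℝ E : ℝ) - 2 * s)) =
      ∫⁻ t in Set.Ioi 0, (ENNReal.ofReal (s * t ^ (s - 1)) *
        (ENNReal.ofReal (‖w‖ ^ (2 - Module.finrank ℝ E : ℝ)) *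
          if t * ‖w‖ ^ 2 < 1 - ‖y + w‖ ^ 2 then 1 else 0)) := by
    filter_upwards [compl_mem_ae_iff.2 (measure_singleton (0 : E))] with w hw
    rw [sub_add_cancel_left, norm_neg,
      ofReal_mul_rpow_eq_lintegral hs (norm_pos_iff.2 hw)]
  rw [lintegral_congr_ae h1, lintegral_lintegral_swap (by
    refine (Measurable.mul (by fun_prop) ?_).aemeasurable
    refine measurable_mul_ite_lt ?_ ?_ ?_ <;> fun_prop)]
  have h2 : ∀ t ∈ Set.Ioi (0 : ℝ), (∫⁻ w : E, (ENNReal.ofReal (s * t ^ (s - 1)) *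
        (ENNReal.ofReal (‖w‖ ^ (2 - Module.finrank ℝ E : ℝ)) *
          if t * ‖w‖ ^ 2 < 1 - ‖y + w‖ ^ 2 then 1 else 0))) =
      (ENNReal.ofReal (s * (1 - ‖y‖ ^ 2) / 2) *
          ENNReal.ofReal (t ^ (s - 1) * (1 / (1 + t)) ^ (1 : ℝ)) +
        ENNReal.ofReal (s * ‖y‖ ^ 2 / Module.finrank ℝ E) *
          ENNReal.ofReal (t ^ (s - 1) * (1 / (1 + t)) ^ (2 : ℝ))) *
        (volume : Measure E).toSphere Set.univ := by
    intro t ht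
    have ht : 0 < t := ht
    rw [lintegral_const_mul _ (by refine measurable_mul_ite_lt ?_ ?_ ?_ <;> fun_prop)]
    have h3 : ∀ w : E, (t * ‖w‖ ^ 2 < 1 - ‖y + w‖ ^ 2) ↔
        ‖w‖ ^ 2 + 2 * inner ℝ ((1 / (1 + t)) • y) w < (1 - ‖y‖ ^ 2) / (1 + t) := by
      intro w
      rw [norm_add_sq_real, real_inner_smul_left, lt_div_iff₀ (by positivity)]
      have : (‖w‖ ^ 2 + 2 * (1 / (1 + t) * inner ℝ y w)) * (1 + t) =
          (1 + t) * ‖w‖ ^ 2 + 2 * inner ℝ y w := by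
        field_simp
      rw [this]
      constructor <;> intro h <;> linarith
    simp_rw [h3]
    rw [lintegral_newtonian_ball (by positivity), ← mul_assoc,
      ← ENNReal.ofReal_mul (by positivity), ← ENNReal.ofReal_mul (by positivity),
      ← ENNReal.ofReal_mul (by positivity),
      ← ENNReal.ofReal_add (by positivity) (by positivity), rpow_one, rpow_two, norm_smul,
      Real.norm_of_nonneg (by positivity)]
    congr 2
    field_simp
  have hΓ := Real.Gamma_pos_of_pos hs
  have hΓ1 := Real.Gamma_pos_of_pos (sub_pos.2 hs1)
  have hΓ2 : Real.Gamma (2 - s) = (1 - s) * Real.Gamma (1 - s) := by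
    rw [← Real.Gamma_add_one (sub_pos.2 hs1).ne']
    congr 1
    ring
  have hs1' : 0 < 1 - s := sub_pos.2 hs1
  rw [setLIntegral_congr_fun measurableSet_Ioi h2, lintegral_mul_const _ (by fun_prop),
    lintegral_add_left (by fun_prop), lintegral_const_mul _ (by fun_prop),
    lintegral_const_mul _ (by fun_prop), lintegral_rpow_mul_one_add_rpow hs hs1,
    lintegral_rpow_mul_one_add_rpow hs (by linarith), hΓ2, Real.Gamma_one, Real.Gamma_two,
    ← ENNReal.ofReal_mul (by positivity), ← ENNReal.ofReal_mul (by positivity),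
    ← ENNReal.ofReal_add (by positivity) (by positivity)]
  congr 2
  field_simp
  ring

end InnerProduct

theorem toReal_toSphere_euclideanSpace {d : ℕ} (hd : 1 ≤ d) :
    ((volume : Measure (EuclideanSpace ℝ (Fin d))).toSphere Set.univ).toReal =
      2 * π ^ ((d : ℝ) / 2) / Real.Gamma ((d : ℝ) / 2) := by
  have hd' : (0 : ℝ) < d := by exact_mod_cast hd
  have : Nonempty (Fin d) := ⟨⟨0, hd⟩⟩
  have hΓ := Real.Gamma_pos_of_pos (half_pos hd')
  rw [Measure.toSphere_apply_univ, EuclideanSpace.volume_ball, finrank_euclideanSpace,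
    Fintype.card_fin, Real.Gamma_add_one (by positivity), ENNReal.ofReal_one, one_pow, one_mul,
    ENNReal.toReal_mul, ENNReal.toReal_natCast, ENNReal.toReal_ofReal (by positivity),
    Real.sqrt_eq_rpow, ← rpow_natCast, ← rpow_mul pi_pos.le, one_div_mul_eq_div]
  field_simp

theorem riesz_potential_phi_alpha_inside_ball
    (d : ℕ) (hd : 1 ≤ d) (α : ℝ) (hα : α ∈ Set.Ioo (0 : ℝ) 2) (hαd : 2 - α < d)
    (y : EuclideanSpace ℝ (Fin d)) (hy : ‖y‖ ≤ 1) :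
    rieszPotential d (2 - α) (fun z => (max (1 - ‖z‖ ^ 2) 0) ^ (α / 2)) y =
      (2 ^ (α - 2) * Real.Gamma (α / 2 + 1) * Real.Gamma (((d : ℝ) + α) / 2 - 1) /
          Real.Gamma ((d : ℝ) / 2)) *
        (1 - (((d : ℝ) + α - 2) / (d : ℝ)) * ‖y‖ ^ 2) := by
  obtain ⟨hα0, hα2⟩ := hα
  have hd' : (0 : ℝ) < d := by exact_mod_cast hd
  have : Nonempty (Fin d) := ⟨⟨0, hd⟩⟩
  have hy2 : ‖y‖ ^ 2 ≤ 1 := by nlinarith [norm_nonneg y]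
  have hΓ := Real.Gamma_pos_of_pos (half_pos hα0)
  have hΓ1 := Real.Gamma_pos_of_pos (show 0 < 1 - α / 2 by linarith)
  have hΓd := Real.Gamma_pos_of_pos (half_pos hd')
  have hpos : 0 ≤ 1 - ((d : ℝ) + 2 * (α / 2) - 2) / d * ‖y‖ ^ 2 := by
    have h1 : ((d : ℝ) + 2 * (α / 2) - 2) / d ≤ 1 := by
      rw [div_le_one hd']
      linarith
    nlinarith [sq_nonneg ‖y‖]
  have key := lintegral_riesz_kernel (half_pos hα0) (by linarith : α / 2 < 1) hy
  rw [finrank_euclideanSpace, Fintype.card_fin,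
    show (2 - (d : ℝ)) - 2 * (α / 2) = 2 - α - d by ring] at key
  have hint : ∫ z : EuclideanSpace ℝ (Fin d),
      max (1 - ‖z‖ ^ 2) 0 ^ (α / 2) * ‖y - z‖ ^ (2 - α - (d : ℝ)) =
      α / 2 * Real.Gamma (α / 2) * Real.Gamma (1 - α / 2) / 2 *
        (1 - ((d : ℝ) + 2 * (α / 2) - 2) / d * ‖y‖ ^ 2) *
        (2 * π ^ ((d : ℝ) / 2) / Real.Gamma ((d : ℝ) / 2)) := by
    rw [integral_eq_lintegral_of_nonneg_ae (.of_forall fun z => by positivity)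
      (Measurable.aestronglyMeasurable (by fun_prop)), key, ENNReal.toReal_mul,
      ENNReal.toReal_ofReal (by positivity), toReal_toSphere_euclideanSpace hd]
  rw [rieszPotential, hint, Real.Gamma_add_one (by positivity),
    show ((d : ℝ) - (2 - α)) / 2 = ((d : ℝ) + α) / 2 - 1 by ring,
    show (2 - α) / 2 = 1 - α / 2 by ring, show α - 2 = -(2 - α) by ring,
    rpow_neg two_pos.le]
  have hpi : π ^ ((d : ℝ) / 2) ≠ 0 := by positivity
  have h2 : (2 : ℝ) ^ (2 - α) ≠ 0 := by positivity
  field_simp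
end

section
/- (Getoor) Let d ≥ 1 be an integer and α ∈ (0,2), and let φ_α(y) = (1−|y|²)_+^{α/2}. Then for every y ∈ ℝ^d with |y| < 1, the principal value lim_{ε→0⁺} ∫_{|z|>ε} (φ_α(y) − φ_α(y+z)) |z|^{−d−α} dz exists and (−Δ)^{α/2} φ_α(y) = 2^α Γ(1+α/2) Γ((d+α)/2) / Γ(d/2); equivalently, K_{α,d} · (−Δ)^{α/2} φ_α ≡ 1 on the open unit ball, where K_{α,d} = Γ(d/2)/(2^α Γ(1+α/2) Γ((d+α)/2)). -/
open Real MeasureTheory Filter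

theorem integral_Ioi_rpow_sub_one_div_one_add {a : ℝ} (ha0 : 0 < a) (ha1 : a < 1) :
    ∫ t in Set.Ioi (0 : ℝ), t ^ (a - 1) / (1 + t) = Gamma a * Gamma (1 - a) := by
  have hb : ProbabilityTheory.beta a (1 - a) = Gamma a * Gamma (1 - a) := by
    simp [ProbabilityTheory.beta]
  have hbeta : ProbabilityTheory.beta a (1 - a)
      = ∫ x in Set.Ioo (0 : ℝ) 1, x ^ (a - 1) * (1 - x) ^ (-a) := by
    rw [ProbabilityTheory.beta_eq_betaIntegralReal a (1 - a) ha0 (by linarith),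
      Complex.betaIntegral, intervalIntegral.integral_of_le zero_le_one,
      integral_Ioc_eq_integral_Ioo]
    have : ∫ x in Set.Ioo (0 : ℝ) 1, (x : ℂ) ^ ((a : ℂ) - 1) *
        (1 - (x : ℂ)) ^ (((1 - a : ℝ) : ℂ) - 1)
        = ∫ x in Set.Ioo (0 : ℝ) 1, ((x ^ (a - 1) * (1 - x) ^ (-a) : ℝ) : ℂ) := by
      refine setIntegral_congr_fun measurableSet_Ioo fun x hx => ?_
      rw [Complex.ofReal_mul, Complex.ofReal_cpow hx.1.le,
        Complex.ofReal_cpow (by linarith [hx.2])]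
      push_cast
      ring_nf
    rw [this, integral_complex_ofReal, Complex.ofReal_re]
  have himage : (fun t : ℝ => t / (1 + t)) '' Set.Ioi 0 = Set.Ioo 0 1 := by
    ext x
    constructor
    · rintro ⟨t, ht, rfl⟩
      have ht : 0 < t := ht
      refine ⟨by positivity, ?_⟩
      simp only
      rw [div_lt_one (by linarith)]
      linarith
    · rintro ⟨h0, h1⟩
      have : 0 < 1 - x := by linarith
      refine ⟨x / (1 - x), div_pos h0 this, ?_⟩
      simp only
      field_simp
      ring
  have hinj : Set.InjOn (fun t : ℝ => t / (1 + t)) (Set.Ioi 0) := by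
    intro s hs t ht h
    have hs : 0 < s := hs
    have ht : 0 < t := ht
    simp only at h
    rw [div_eq_div_iff (by positivity) (by positivity)] at h
    linarith
  have hderiv : ∀ t ∈ Set.Ioi (0 : ℝ), HasDerivWithinAt (fun t : ℝ => t / (1 + t))
      (((1 + t) ^ 2)⁻¹) (Set.Ioi 0) t := by
    intro t ht
    have ht : 0 < t := ht
    have h := (hasDerivAt_id t).div ((hasDerivAt_id t).const_add 1) (by simp; positivity)
    refine (h.congr_deriv ?_).hasDerivWithinAt
    simp
  rw [← hb, hbeta, ← himage, integral_image_eq_integral_abs_deriv_smul measurableSet_Ioi hderiv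
    hinj]
  refine setIntegral_congr_fun measurableSet_Ioi fun t ht => ?_
  have ht : 0 < t := ht
  have h1 : 0 < 1 + t := by positivity
  have h2 : 1 - t / (1 + t) = (1 + t)⁻¹ := by field_simp; ring
  simp only [smul_eq_mul]
  rw [h2, abs_of_pos (by positivity), div_rpow ht.le h1.le, inv_rpow h1.le, rpow_neg h1.le,
    inv_inv, rpow_sub_one h1.ne']
  have := (rpow_pos_of_pos h1 a).ne'
  field_simp

theorem integrableOn_Ioi_rpow_sub_one_div_one_add {a : ℝ} (ha0 : 0 < a) (ha1 : a < 1) :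
    IntegrableOn (fun t : ℝ => t ^ (a - 1) / (1 + t)) (Set.Ioi 0) := by
  refine (integrableOn_rpowIntegrand₀₁_Ioi ⟨ha0, ha1⟩ zero_le_one).congr_fun (fun t ht => ?_)
    measurableSet_Ioi
  have ht : 0 < t := ht
  simp only [Real.rpowIntegrand₀₁, rpow_sub_one ht.ne']
  field_simp
  ring

theorem tendsto_integral_rpow_sub_one_div_one_add {a : ℝ} (ha0 : 0 < a) (ha1 : a < 1) :
    Tendsto (fun M : ℝ => M ^ a / a - ∫ t in (0 : ℝ)..M, t ^ a / (1 + t)) atTop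
      (nhds (Gamma a * Gamma (1 - a))) := by
  rw [← integral_Ioi_rpow_sub_one_div_one_add ha0 ha1]
  refine (intervalIntegral_tendsto_integral_Ioi 0
    (integrableOn_Ioi_rpow_sub_one_div_one_add ha0 ha1) tendsto_id).congr' ?_
  filter_upwards [eventually_gt_atTop 0] with M hM
  have h1 : ∫ t in (0 : ℝ)..M, t ^ (a - 1) = M ^ a / a := by
    rw [integral_rpow (Or.inl (by linarith))]
    simp [ha0.ne']
  have hc : ContinuousOn (fun t : ℝ => t ^ a / (1 + t)) (Set.uIcc 0 M) := by
    rw [Set.uIcc_of_le hM.le]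
    refine ContinuousOn.div (continuousOn_id.rpow_const fun _ _ => Or.inr ha0.le) (by fun_prop) ?_
    intro t ht
    have := ht.1
    positivity
  rw [← h1, ← intervalIntegral.integral_sub (intervalIntegral.intervalIntegrable_rpow'
    (by linarith)) hc.intervalIntegrable]
  refine intervalIntegral.integral_congr_ae (ae_of_all _ fun t ht => ?_)
  rw [id, Set.uIoc_of_le hM.le] at ht
  have ht := ht.1
  rw [rpow_sub_one ht.ne']
  field_simp
  ring
theorem one_add_mul_sub_sq_le_rpow {a x : ℝ} (ha0 : 0 < a) (ha1 : a < 1) (hx : |x| ≤ 1 / 2) :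
    1 + a * x - 2 * x ^ 2 ≤ (1 + x) ^ a := by
  obtain ⟨h1, h2⟩ := abs_le.1 hx
  have hpos : 0 < 1 + x := by linarith
  have h := rpow_one_add_le_one_add_mul_self (s := x) (p := 1 - a) (by linarith) (by linarith)
    (by linarith)
  rw [rpow_sub hpos, rpow_one, div_le_iff₀ (rpow_pos_of_pos hpos a)] at h
  have hq : 1 / 2 ≤ 1 + (1 - a) * x := by nlinarith
  refine le_of_mul_le_mul_left (le_trans ?_ h) (by linarith : (0 : ℝ) < 1 + (1 - a) * x)
  nlinarith [mul_nonneg (sub_nonneg.2 hq) (sq_nonneg x), mul_pos ha0 (sub_pos.2 ha1), sq_nonneg x,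
    sq_nonneg (1 - 2 * a), mul_nonneg (mul_pos ha0 (sub_pos.2 ha1)).le (sq_nonneg x)]

theorem abs_rpow_add_sub_rpow_sub_le {a A h : ℝ} (ha0 : 0 < a) (ha1 : a < 1) (hA : 0 < A)
    (hh : |h| ≤ A / 2) :
    |(A + h) ^ a - A ^ a - A ^ a * (a * (h / A))| ≤ A ^ a * (2 * (h / A) ^ 2) := by
  have hx : |h / A| ≤ 1 / 2 := by
    rw [abs_div, abs_of_pos hA, div_le_iff₀ hA]
    linarith
  have h1 := one_add_mul_sub_sq_le_rpow ha0 ha1 hx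
  have h2 := rpow_one_add_le_one_add_mul_self (s := h / A) (p := a)
    (by linarith [(abs_le.1 hx).1]) ha0.le ha1.le
  have h3 : (A + h) ^ a = A ^ a * (1 + h / A) ^ a := by
    rw [← mul_rpow hA.le (by linarith [(abs_le.1 hx).1])]
    congr 1
    field_simp
  have hp := rpow_pos_of_pos hA a
  rw [h3, show A ^ a * (1 + h / A) ^ a - A ^ a - A ^ a * (a * (h / A))
    = A ^ a * ((1 + h / A) ^ a - 1 - a * (h / A)) by ring, abs_mul, abs_of_pos hp]
  refine mul_le_mul_of_nonneg_left (abs_le.2 ⟨by linarith, ?_⟩) hp.le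
  nlinarith [sq_nonneg (h / A)]

/-- The symmetric second difference at `0` of the profile `r ↦ (A + 2 b r - r²)₊ ^ a`. -/
noncomputable def profileSecondDiff (a A b r : ℝ) : ℝ :=
  2 * A ^ a - (max (A + 2 * b * r - r ^ 2) 0) ^ a - (max (A - 2 * b * r - r ^ 2) 0) ^ a

theorem exists_abs_profileSecondDiff_le {a A B : ℝ} (ha0 : 0 < a) (ha1 : a < 1) (hA : 0 < A)
    (hB : 0 ≤ B) : ∃ C, 0 ≤ C ∧ ∀ b r : ℝ, |b| ≤ B → 0 ≤ r →
      |profileSecondDiff a A b r| ≤ C ∧ |profileSecondDiff a A b r| ≤ C * r ^ 2 := by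
  set T : ℝ := 2 * (A + B ^ 2) ^ a + 2 * A ^ a with hT
  have hA' : 0 < A ^ a := rpow_pos_of_pos hA a
  have hAB : 0 ≤ (A + B ^ 2) ^ a := by positivity
  have hT0 : 0 ≤ T := by positivity
  have hbound : ∀ b r : ℝ, |b| ≤ B → |profileSecondDiff a A b r| ≤ T := by
    intro b r hb
    have hb2 : b ^ 2 ≤ B ^ 2 := sq_le_sq' (by linarith [(abs_le.1 hb).1]) (abs_le.1 hb).2
    have h1 : (max (A + 2 * b * r - r ^ 2) 0) ^ a ≤ (A + B ^ 2) ^ a := by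
      refine rpow_le_rpow (le_max_right _ _) (max_le ?_ (by positivity)) ha0.le
      nlinarith [sq_nonneg (b - r)]
    have h2 : (max (A - 2 * b * r - r ^ 2) 0) ^ a ≤ (A + B ^ 2) ^ a := by
      refine rpow_le_rpow (le_max_right _ _) (max_le ?_ (by positivity)) ha0.le
      nlinarith [sq_nonneg (b + r)]
    have h3 : 0 ≤ (max (A + 2 * b * r - r ^ 2) 0) ^ a := by positivity
    have h4 : 0 ≤ (max (A - 2 * b * r - r ^ 2) 0) ^ a := by positivity
    rw [profileSecondDiff, abs_le]
    constructor <;> linarith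
  set δ : ℝ := min 1 (A / (4 * B + 2)) with hδ
  have hδ0 : 0 < δ := lt_min one_pos (by positivity)
  set S : ℝ := A ^ a * (4 * ((2 * B + 1) / A) ^ 2) + A ^ a * (2 * a / A) with hS
  have hS0 : 0 ≤ S := by positivity
  have hsmall : ∀ b r : ℝ, |b| ≤ B → 0 ≤ r → r ≤ δ → |profileSecondDiff a A b r| ≤ S * r ^ 2 := by
    intro b r hb hr hrδ
    obtain ⟨hb1, hb2⟩ := abs_le.1 hb
    have hr1 : r ≤ 1 := hrδ.trans (min_le_left _ _)
    have hr2 : r * (4 * B + 2) ≤ A := by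
      rw [← le_div_iff₀ (by positivity)]
      exact hrδ.trans (min_le_right _ _)
    have hrr : r ^ 2 ≤ r := by nlinarith
    have key : ∀ h, |h| ≤ (2 * B + 1) * r →
        |(A + h) ^ a - A ^ a - A ^ a * (a * (h / A))|
          ≤ A ^ a * (2 * (((2 * B + 1) / A) ^ 2 * r ^ 2)) := by
      intro h hh
      refine (abs_rpow_add_sub_rpow_sub_le ha0 ha1 hA (by linarith)).trans ?_
      have : (h / A) ^ 2 ≤ ((2 * B + 1) / A) ^ 2 * r ^ 2 := by
        rw [← mul_pow, ← sq_abs, abs_div, abs_of_pos hA]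
        refine pow_le_pow_left₀ (by positivity) ?_ 2
        rw [div_mul_eq_mul_div]
        gcongr
      gcongr
    have hp : |2 * b * r - r ^ 2| ≤ (2 * B + 1) * r := by
      rw [abs_le]; constructor <;> nlinarith
    have hm : |-(2 * b * r) - r ^ 2| ≤ (2 * B + 1) * r := by
      rw [abs_le]; constructor <;> nlinarith
    have kp := key _ hp
    have km := key _ hm
    have ep : max (A + 2 * b * r - r ^ 2) 0 = A + (2 * b * r - r ^ 2) := by
      rw [max_eq_left] <;> linarith [(abs_le.1 hp).1]
    have em : max (A - 2 * b * r - r ^ 2) 0 = A + (-(2 * b * r) - r ^ 2) := by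
      rw [max_eq_left] <;> linarith [(abs_le.1 hm).1]
    rw [profileSecondDiff, ep, em]
    have e : A ^ a * (a * ((2 * b * r - r ^ 2) / A)) + A ^ a * (a * ((-(2 * b * r) - r ^ 2) / A))
        = -(A ^ a * (2 * a / A) * r ^ 2) := by
      ring
    have hn : 0 ≤ A ^ a * (2 * a / A) * r ^ 2 := by positivity
    obtain ⟨kp1, kp2⟩ := abs_le.1 kp
    obtain ⟨km1, km2⟩ := abs_le.1 km
    rw [abs_le]
    constructor <;> nlinarith
  refine ⟨max (max S T) (T / δ ^ 2), by positivity, fun b r hb hr =>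
    ⟨(hbound b r hb).trans ((le_max_right _ _).trans (le_max_left _ _)), ?_⟩⟩
  rcases le_total r δ with h | h
  · refine (hsmall b r hb hr h).trans ?_
    gcongr
    exact (le_max_left _ _).trans (le_max_left _ _)
  · refine (hbound b r hb).trans ?_
    calc T = T / δ ^ 2 * δ ^ 2 := by field_simp
      _ ≤ _ := by gcongr; exact le_max_right _ _
theorem integral_Ioi_profile_mul_rpow {a A b ε : ℝ} (ha0 : 0 < a) (hA : 0 < A)
    (hε : 0 < ε) (hM : 0 < A + 2 * b * ε - ε ^ 2) :
    ∫ r in Set.Ioi ε, (max (A + 2 * b * r - r ^ 2) 0) ^ a * r ^ (-1 - 2 * a) =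
      1 / 2 * ∫ μ in (0 : ℝ)..((A + 2 * b * ε - ε ^ 2) / ε ^ 2),
        μ ^ a / (1 + μ) * (1 + b / √(b ^ 2 + A * (1 + μ))) := by
  set F : ℝ → ℝ := fun r => (max (A + 2 * b * r - r ^ 2) 0) ^ a * r ^ (-1 - 2 * a) with hF
  set σ : ℝ → ℝ := fun μ => √(b ^ 2 + A * (1 + μ)) with hσ
  set g : ℝ → ℝ := fun μ => A / (σ μ - b) with hg
  set M : ℝ := (A + 2 * b * ε - ε ^ 2) / ε ^ 2 with hMdef
  have hM0 : 0 < M := by positivity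
  have hσsq : ∀ μ, 0 ≤ μ → σ μ ^ 2 = b ^ 2 + A * (1 + μ) := fun μ hμ => sq_sqrt (by positivity)
  have hσpos : ∀ μ, 0 ≤ μ → 0 < σ μ := fun μ hμ => sqrt_pos.2 (by positivity)
  have hσb : ∀ μ, 0 ≤ μ → 0 < σ μ - b := by
    intro μ hμ
    have : b < σ μ := by
      refine lt_of_le_of_lt (le_abs_self b) ?_
      rw [← sqrt_sq_eq_abs]
      exact sqrt_lt_sqrt (sq_nonneg b) (by nlinarith [mul_pos hA (by linarith : 0 < 1 + μ)])
    linarith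
  have hgpos : ∀ μ, 0 ≤ μ → 0 < g μ := fun μ hμ => div_pos hA (hσb μ hμ)
  have hgeq : ∀ μ, 0 ≤ μ → A + 2 * b * g μ - g μ ^ 2 = μ * g μ ^ 2 := by
    intro μ hμ
    have h1 := hσsq μ hμ
    have h2 := (hσb μ hμ).ne'
    simp only [hg]
    field_simp
    linear_combination h1
  have hgM : g M = ε := by
    have h1 : 0 < A + b * ε := by nlinarith [sq_nonneg ε]
    have h2 : σ M = A / ε + b := by
      have : A / ε + b = (A + b * ε) / ε := by field_simp
      simp only [hσ]
      rw [sqrt_eq_iff_mul_self_eq (by positivity) (by rw [this]; positivity), hMdef]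
      field_simp
      ring
    simp only [hg, h2]
    field_simp
    simp [hA.ne']
  have hr0 := hgpos 0 le_rfl
  have hr0eq : A + 2 * b * g 0 - g 0 ^ 2 = 0 := by simpa using hgeq 0 le_rfl
  have hr02b : 0 < g 0 - 2 * b := by
    have : 0 < g 0 * (g 0 - 2 * b) := by nlinarith
    exact (pos_iff_pos_of_mul_pos this).1 hr0
  have hεr0 : ε < g 0 := by
    by_contra! h
    nlinarith [mul_nonneg (sub_nonneg.2 h) (by linarith : 0 ≤ ε + g 0 - 2 * b)]
  have hFzero : ∀ r, g 0 < r → F r = 0 := by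
    intro r hr
    have : A + 2 * b * r - r ^ 2 ≤ 0 := by
      nlinarith [mul_nonneg (sub_nonneg.2 hr.le) (by linarith : 0 ≤ r + g 0 - 2 * b)]
    simp only [hF]
    rw [max_eq_right this, zero_rpow ha0.ne', zero_mul]
  have hderiv : ∀ μ ∈ Set.uIcc 0 M,
      HasDerivAt g (-(A * (A / (2 * σ μ)) / (σ μ - b) ^ 2)) μ := by
    intro μ hμ
    rw [Set.uIcc_of_le hM0.le] at hμ
    have hs : HasDerivAt σ (A / (2 * σ μ)) μ := by
      have := ((((hasDerivAt_id μ).const_add 1).const_mul A).const_add (b ^ 2)).sqrt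
        (by simp only [id]; have := hμ.1; positivity)
      simpa [hσ] using this
    have := (hasDerivAt_const μ A).div (hs.sub_const b) (hσb μ hμ.1).ne'
    refine this.congr_deriv ?_
    ring
  have hσcont : Continuous σ := by fun_prop
  have hcont' : ContinuousOn (fun μ => -(A * (A / (2 * σ μ)) / (σ μ - b) ^ 2))
      (Set.uIcc 0 M) := by
    rw [Set.uIcc_of_le hM0.le]
    refine ContinuousOn.neg (ContinuousOn.div (continuousOn_const.mul
      (continuousOn_const.div (by fun_prop) ?_)) (by fun_prop) ?_)
    · intro μ hμ
      have := hσpos μ hμ.1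
      positivity
    · intro μ hμ
      have := hσb μ hμ.1
      positivity
  have hFcont : ContinuousOn F (g '' Set.uIcc 0 M) := by
    rw [Set.uIcc_of_le hM0.le]
    refine ContinuousOn.mul (ContinuousOn.rpow_const (by fun_prop) fun _ _ => Or.inr ha0.le)
      (continuousOn_id.rpow_const ?_)
    rintro _ ⟨μ, hμ, rfl⟩
    exact Or.inl (hgpos μ hμ.1).ne'
  have hsub := intervalIntegral.integral_comp_mul_deriv' hderiv hcont' hFcont
  rw [hgM] at hsub
  have hleft : ∫ r in Set.Ioi ε, F r = ∫ r in ε..(g 0), F r := by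
    rw [intervalIntegral.integral_of_le hεr0.le]
    refine setIntegral_eq_of_subset_of_forall_sdiff_eq_zero measurableSet_Ioi
      Set.Ioc_subset_Ioi_self ?_
    rintro r ⟨h1, h2⟩
    refine hFzero r ?_
    by_contra! h
    exact h2 ⟨h1, h⟩
  rw [hleft, intervalIntegral.integral_symm, ← hsub, ← intervalIntegral.integral_neg,
    ← intervalIntegral.integral_const_mul]
  refine intervalIntegral.integral_congr fun μ hμ => ?_
  rw [Set.uIcc_of_le hM0.le] at hμ
  have hμ := hμ.1
  have hgp := hgpos μ hμ
  have hFg : F (g μ) = μ ^ a * (g μ)⁻¹ := by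
    simp only [hF]
    rw [hgeq μ hμ, max_eq_left (by positivity), mul_rpow hμ (by positivity), ← rpow_natCast,
      ← rpow_mul hgp.le, mul_assoc, ← rpow_add hgp, ← rpow_neg_one]
    congr 2
    push_cast
    ring
  simp only [Function.comp]
  rw [hFg]
  have h1 := hσsq μ hμ
  have h2 := (hσb μ hμ).ne'
  have h3 := (hσpos μ hμ).ne'
  have h4 : (1 + μ) ≠ 0 := by positivity
  change _ = 1 / 2 * (μ ^ a / (1 + μ) * (1 + b / σ μ))
  simp only [hg]
  field_simp
  linear_combination (-μ ^ a) * h1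
theorem integrableOn_Ioi_profile_mul_rpow {a A b ε : ℝ} (ha0 : 0 < a) (hA : 0 < A)
    (hε : 0 < ε) :
    IntegrableOn (fun r : ℝ => (max (A + 2 * b * r - r ^ 2) 0) ^ a * r ^ (-1 - 2 * a))
      (Set.Ioi ε) := by
  refine Integrable.bdd_mul (c := (A + b ^ 2) ^ a)
    (integrableOn_Ioi_rpow_of_lt (by linarith) hε) ?_ (ae_of_all _ fun r => ?_)
  · exact (Measurable.pow_const (by fun_prop) a).aestronglyMeasurable
  · rw [norm_of_nonneg (by positivity)]
    refine rpow_le_rpow (le_max_right _ _) (max_le ?_ (by positivity)) ha0.le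
    nlinarith [sq_nonneg (b - r)]

theorem tendsto_integral_correction {a A b : ℝ} (ha0 : 0 < a) (ha1 : a < 1) (hA : 0 < A) :
    Tendsto (fun ε : ℝ => ∫ μ in ((A - 2 * b * ε - ε ^ 2) / ε ^ 2)..((A + 2 * b * ε - ε ^ 2) / ε ^ 2),
        μ ^ a / (1 + μ) * (1 / √(b ^ 2 + A * (1 + μ)))) (nhdsWithin 0 (Set.Ioi 0)) (nhds 0) := by
  have hlim : Tendsto (fun ε : ℝ => (A / 2) ^ (a - 3 / 2) / √A * (4 * |b|) * ε ^ (2 - 2 * a))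
      (nhdsWithin 0 (Set.Ioi 0)) (nhds 0) := by
    have h : Tendsto (fun ε : ℝ => ε ^ (2 - 2 * a)) (nhds 0) (nhds ((0 : ℝ) ^ (2 - 2 * a))) :=
      (continuousAt_rpow_const 0 (2 - 2 * a) (Or.inr (by linarith))).tendsto
    rw [zero_rpow (by linarith)] at h
    simpa using (h.mono_left nhdsWithin_le_nhds).const_mul
      ((A / 2) ^ (a - 3 / 2) / √A * (4 * |b|))
  refine squeeze_zero_norm' ?_ hlim
  have hsmall : ∀ᶠ ε : ℝ in nhdsWithin 0 (Set.Ioi 0), 2 * |b| * ε + ε ^ 2 < A / 2 := by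
    have h : Tendsto (fun ε : ℝ => 2 * |b| * ε + ε ^ 2) (nhds 0) (nhds 0) := by
      have : Continuous fun ε : ℝ => 2 * |b| * ε + ε ^ 2 := by fun_prop
      simpa using this.tendsto 0
    exact (h.eventually_lt_const (by positivity)).filter_mono nhdsWithin_le_nhds
  filter_upwards [hsmall, self_mem_nhdsWithin] with ε h hε
  have hε : 0 < ε := hε
  have hb1 : b * ε ≤ |b| * ε := mul_le_mul_of_nonneg_right (le_abs_self b) hε.le
  have hb2 : -(b * ε) ≤ |b| * ε := by
    rw [← neg_mul]; exact mul_le_mul_of_nonneg_right (neg_le_abs b) hε.le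
  set m : ℝ := A / 2 / ε ^ 2 with hm
  have hm0 : 0 < m := by positivity
  have hbound : ∀ μ ∈ Set.uIoc ((A - 2 * b * ε - ε ^ 2) / ε ^ 2) ((A + 2 * b * ε - ε ^ 2) / ε ^ 2),
      ‖μ ^ a / (1 + μ) * (1 / √(b ^ 2 + A * (1 + μ)))‖ ≤ m ^ (a - 3 / 2) / √A := by
    intro μ hμ
    have hmμ : m ≤ μ := by
      have h1 := (Set.uIoc_subset_uIcc hμ).1
      refine le_trans (le_inf ?_ ?_) h1 <;> rw [hm] <;> gcongr <;> linarith
    have hμ0 : 0 < μ := hm0.trans_le hmμ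
    rw [norm_of_nonneg (by positivity)]
    calc μ ^ a / (1 + μ) * (1 / √(b ^ 2 + A * (1 + μ)))
        ≤ μ ^ a / μ * (1 / √(A * μ)) := by
          gcongr
          · linarith
          · nlinarith [sq_nonneg b]
      _ = μ ^ (a - 3 / 2) / √A := by
          rw [sqrt_mul hA.le, show a - 3 / 2 = a - 1 - 1 / 2 by ring, rpow_sub hμ0 (a - 1),
            rpow_sub_one hμ0.ne', ← sqrt_eq_rpow]
          field_simp
      _ ≤ m ^ (a - 3 / 2) / √A := by
          gcongr ?_ / _
          exact rpow_le_rpow_of_nonpos hm0 hmμ (by linarith)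
  refine (intervalIntegral.norm_integral_le_of_norm_le_const hbound).trans (le_of_eq ?_)
  have h1 : (A + 2 * b * ε - ε ^ 2) / ε ^ 2 - (A - 2 * b * ε - ε ^ 2) / ε ^ 2 = 4 * b / ε := by
    field_simp
    ring
  have h2 : m ^ (a - 3 / 2) = (A / 2) ^ (a - 3 / 2) * ε ^ (2 - 2 * a) * ε := by
    rw [hm, div_rpow (by positivity) (by positivity), ← rpow_natCast ε 2, ← rpow_mul hε.le,
      div_eq_mul_inv, ← rpow_neg hε.le, mul_assoc, ← rpow_add_one hε.ne']
    congr 2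
    push_cast
    ring
  rw [h1, h2, abs_div, abs_mul, abs_of_pos hε, abs_of_pos (by norm_num : (0 : ℝ) < 4)]
  field_simp

theorem tendsto_integral_Ioi_profileSecondDiff {a A : ℝ} (b : ℝ) (ha0 : 0 < a) (ha1 : a < 1)
    (hA : 0 < A) :
    Tendsto (fun ε : ℝ => ∫ r in Set.Ioi ε, profileSecondDiff a A b r * r ^ (-1 - 2 * a))
      (nhdsWithin 0 (Set.Ioi 0)) (nhds (Gamma a * Gamma (1 - a))) := by
  set Φ : ℝ → ℝ := fun M => M ^ a / a - ∫ t in (0 : ℝ)..M, t ^ a / (1 + t) with hΦ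
  have hcutoff : ∀ b : ℝ, Tendsto (fun ε : ℝ => (A + 2 * b * ε - ε ^ 2) / ε ^ 2)
      (nhdsWithin 0 (Set.Ioi 0)) atTop := by
    intro b
    have h1 : Tendsto (fun ε : ℝ => A + 2 * b * ε - ε ^ 2) (nhdsWithin 0 (Set.Ioi 0)) (nhds A) := by
      have : Continuous fun ε : ℝ => A + 2 * b * ε - ε ^ 2 := by fun_prop
      simpa using (this.tendsto 0).mono_left nhdsWithin_le_nhds
    have h2 : Tendsto (fun ε : ℝ => (ε ^ 2)⁻¹) (nhdsWithin 0 (Set.Ioi 0)) atTop := by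
      refine tendsto_inv_nhdsGT_zero.comp (tendsto_nhdsWithin_iff.2 ⟨?_, ?_⟩)
      · have : Continuous fun ε : ℝ => ε ^ 2 := by fun_prop
        simpa using (this.tendsto 0).mono_left nhdsWithin_le_nhds
      · filter_upwards [self_mem_nhdsWithin] with ε hε
        exact pow_pos (Set.mem_Ioi.1 hε) 2
    simpa [div_eq_mul_inv] using h1.pos_mul_atTop hA h2
  have hΦlim := tendsto_integral_rpow_sub_one_div_one_add ha0 ha1
  have hmain : Tendsto (fun ε : ℝ => ε ^ (-2 * a) / (2 * a) * profileSecondDiff a A b ε)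
      (nhdsWithin 0 (Set.Ioi 0)) (nhds 0) := by
    obtain ⟨C, hC, hbd⟩ := exists_abs_profileSecondDiff_le ha0 ha1 hA (abs_nonneg b)
    have hlim : Tendsto (fun ε : ℝ => C / (2 * a) * ε ^ (2 - 2 * a))
        (nhdsWithin 0 (Set.Ioi 0)) (nhds 0) := by
      have h : Tendsto (fun ε : ℝ => ε ^ (2 - 2 * a)) (nhds 0) (nhds ((0 : ℝ) ^ (2 - 2 * a))) :=
        (continuousAt_rpow_const 0 (2 - 2 * a) (Or.inr (by linarith))).tendsto
      rw [zero_rpow (by linarith)] at h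
      simpa using (h.mono_left nhdsWithin_le_nhds).const_mul (C / (2 * a))
    refine squeeze_zero_norm' ?_ hlim
    filter_upwards [self_mem_nhdsWithin] with ε hε
    have hε : 0 < ε := hε
    have hp : 0 < ε ^ (-2 * a) := rpow_pos_of_pos hε _
    rw [norm_mul, norm_of_nonneg (by positivity), norm_eq_abs]
    calc ε ^ (-2 * a) / (2 * a) * |profileSecondDiff a A b ε|
        ≤ ε ^ (-2 * a) / (2 * a) * (C * ε ^ 2) := by
          gcongr
          exact (hbd b ε le_rfl hε.le).2
      _ = C / (2 * a) * ε ^ (2 - 2 * a) := by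
          rw [show 2 - 2 * a = -2 * a + (2 : ℕ) by push_cast; ring, rpow_add hε, rpow_natCast]
          ring
  have hsum := ((hmain.add (((hΦlim.comp (hcutoff b)).add
    (hΦlim.comp (hcutoff (-b)))).const_mul (1 / 2))).sub
    ((tendsto_integral_correction (b := b) ha0 ha1 hA).const_mul (b / 2)))
  rw [show 0 + 1 / 2 * (Gamma a * Gamma (1 - a) + Gamma a * Gamma (1 - a)) - b / 2 * 0
    = Gamma a * Gamma (1 - a) by ring] at hsum
  refine hsum.congr' ?_
  filter_upwards [self_mem_nhdsWithin, (hcutoff b).eventually_gt_atTop 0,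
    (hcutoff (-b)).eventually_gt_atTop 0] with ε hε hp hm
  have hε : 0 < ε := hε
  have hε2 : 0 < ε ^ 2 := by positivity
  have hp' := (div_pos_iff_of_pos_right hε2).1 hp
  have hm' := (div_pos_iff_of_pos_right hε2).1 hm
  have esub : ∀ r : ℝ, A - 2 * b * r - r ^ 2 = A + 2 * (-b) * r - r ^ 2 := fun r => by ring
  have hI1 : IntegrableOn (fun r : ℝ => 2 * A ^ a * r ^ (-1 - 2 * a)) (Set.Ioi ε) :=
    (integrableOn_Ioi_rpow_of_lt (by linarith) hε).const_mul _
  have hI2 := integrableOn_Ioi_profile_mul_rpow (b := b) ha0 hA hε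
  have hI3 := integrableOn_Ioi_profile_mul_rpow (b := -b) ha0 hA hε
  have hsplit : ∫ r in Set.Ioi ε, profileSecondDiff a A b r * r ^ (-1 - 2 * a) =
      (∫ r in Set.Ioi ε, 2 * A ^ a * r ^ (-1 - 2 * a))
      - (∫ r in Set.Ioi ε, (max (A + 2 * b * r - r ^ 2) 0) ^ a * r ^ (-1 - 2 * a))
      - ∫ r in Set.Ioi ε, (max (A + 2 * (-b) * r - r ^ 2) 0) ^ a * r ^ (-1 - 2 * a) := by
    have hI12 : IntegrableOn (fun r : ℝ => 2 * A ^ a * r ^ (-1 - 2 * a) -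
        (max (A + 2 * b * r - r ^ 2) 0) ^ a * r ^ (-1 - 2 * a)) (Set.Ioi ε) := hI1.sub hI2
    rw [← integral_sub hI1 hI2, ← integral_sub hI12 hI3]
    refine integral_congr_ae (ae_of_all _ fun r => ?_)
    simp only [profileSecondDiff, esub]
    ring
  have hH : ∀ M : ℝ, 0 < M →
      IntervalIntegrable (fun μ : ℝ => μ ^ a / (1 + μ)) volume 0 M := by
    intro M hM
    refine ContinuousOn.intervalIntegrable ?_
    rw [Set.uIcc_of_le hM.le]
    refine ContinuousOn.div (continuousOn_id.rpow_const fun _ _ => Or.inr ha0.le) (by fun_prop) ?_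
    intro t ht
    have := ht.1
    positivity
  have hK : ∀ M : ℝ, 0 < M →
      IntervalIntegrable (fun μ : ℝ => μ ^ a / (1 + μ) * (1 / √(b ^ 2 + A * (1 + μ))))
        volume 0 M := by
    intro M hM
    refine (hH M hM).mul_continuousOn ?_
    rw [Set.uIcc_of_le hM.le]
    refine ContinuousOn.div continuousOn_const (by fun_prop) ?_
    intro t ht
    have := ht.1
    exact (sqrt_pos.2 (by positivity)).ne'
  have hJ : ∀ b' : ℝ, b' ^ 2 = b ^ 2 → ∀ M : ℝ, 0 < M →
      ∫ μ in (0 : ℝ)..M, μ ^ a / (1 + μ) * (1 + b' / √(b' ^ 2 + A * (1 + μ))) =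
      (∫ μ in (0 : ℝ)..M, μ ^ a / (1 + μ)) +
        b' * ∫ μ in (0 : ℝ)..M, μ ^ a / (1 + μ) * (1 / √(b ^ 2 + A * (1 + μ))) := by
    intro b' hb' M hM
    rw [← intervalIntegral.integral_const_mul, ← intervalIntegral.integral_add (hH M hM)
      ((hK M hM).const_mul b'), hb']
    refine intervalIntegral.integral_congr fun μ _ => ?_
    ring
  have hE : (∫ μ in ((A - 2 * b * ε - ε ^ 2) / ε ^ 2)..((A + 2 * b * ε - ε ^ 2) / ε ^ 2),
        μ ^ a / (1 + μ) * (1 / √(b ^ 2 + A * (1 + μ)))) =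
      (∫ μ in (0 : ℝ)..((A + 2 * b * ε - ε ^ 2) / ε ^ 2),
        μ ^ a / (1 + μ) * (1 / √(b ^ 2 + A * (1 + μ)))) -
      ∫ μ in (0 : ℝ)..((A + 2 * (-b) * ε - ε ^ 2) / ε ^ 2),
        μ ^ a / (1 + μ) * (1 / √(b ^ 2 + A * (1 + μ))) := by
    rw [intervalIntegral.integral_interval_sub_left (hK _ hp) (hK _ hm), esub]
  have hpow : ∀ b' : ℝ, 0 < A + 2 * b' * ε - ε ^ 2 →
      ((A + 2 * b' * ε - ε ^ 2) / ε ^ 2) ^ a =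
        (A + 2 * b' * ε - ε ^ 2) ^ a * ε ^ (-2 * a) := by
    intro b' h
    rw [div_rpow h.le hε2.le, div_eq_mul_inv, ← rpow_natCast ε 2, ← rpow_mul hε.le,
      ← rpow_neg hε.le]
    congr 2
    push_cast
    ring
  rw [hsplit, integral_Ioi_profile_mul_rpow ha0 hA hε hp', integral_Ioi_profile_mul_rpow ha0 hA hε
    hm', hJ b rfl _ hp, hJ (-b) (by ring) _ hm, hE, integral_const_mul,
    integral_Ioi_rpow_of_lt (by linarith) hε]
  simp only [Function.comp, profileSecondDiff]
  rw [hpow b hp', hpow (-b) hm', esub, max_eq_left hp'.le, max_eq_left hm'.le,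
    show -1 - 2 * a + 1 = -2 * a by ring]
  field_simp
  ring

theorem integrableOn_Ioi_min_sq_mul_rpow {a : ℝ} (ha0 : 0 < a) (ha1 : a < 1) :
    IntegrableOn (fun r : ℝ => min 1 (r ^ 2) * r ^ (-1 - 2 * a)) (Set.Ioi 0) := by
  rw [← Set.Ioc_union_Ioi_eq_Ioi (zero_le_one (α := ℝ))]
  refine IntegrableOn.union ?_ ?_
  · have h := (intervalIntegral.intervalIntegrable_rpow' (a := 0) (b := 1)
      (by linarith : -1 < 1 - 2 * a)).1
    refine h.congr_fun (fun r hr => ?_) measurableSet_Ioc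
    have h0 : 0 < r := hr.1
    simp only
    rw [min_eq_right (by nlinarith [hr.2]), ← rpow_natCast, ← rpow_add h0]
    congr 1
    push_cast
    ring
  · refine (integrableOn_Ioi_rpow_of_lt (by linarith : -1 - 2 * a < -1) one_pos).congr_fun
      (fun r hr => ?_) measurableSet_Ioi
    have h1 : 1 < r := hr
    simp only
    rw [min_eq_left (by nlinarith), one_mul]

theorem exists_abs_profileSecondDiff_le_min {a A B : ℝ} (ha0 : 0 < a) (ha1 : a < 1) (hA : 0 < A)
    (hB : 0 ≤ B) : ∃ C, ∀ b r : ℝ, |b| ≤ B → 0 ≤ r →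
      |profileSecondDiff a A b r| ≤ C * min 1 (r ^ 2) := by
  obtain ⟨C, hC, h⟩ := exists_abs_profileSecondDiff_le ha0 ha1 hA hB
  refine ⟨C, fun b r hb hr => ?_⟩
  rw [mul_min_of_nonneg _ _ hC, mul_one]
  exact le_min (h b r hb hr).1 (h b r hb hr).2

theorem integral_Ioi_profileSecondDiff {a A : ℝ} (b : ℝ) (ha0 : 0 < a) (ha1 : a < 1)
    (hA : 0 < A) :
    ∫ r in Set.Ioi 0, profileSecondDiff a A b r * r ^ (-1 - 2 * a) = Gamma a * Gamma (1 - a) := by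
  obtain ⟨C, hC⟩ := exists_abs_profileSecondDiff_le_min ha0 ha1 hA (abs_nonneg b)
  have hint : IntegrableOn (fun r => profileSecondDiff a A b r * r ^ (-1 - 2 * a))
      (Set.Ioi 0) := by
    refine ((integrableOn_Ioi_min_sq_mul_rpow ha0 ha1).const_mul C).mono' ?_ ?_
    · refine Measurable.aestronglyMeasurable ?_
      unfold profileSecondDiff
      fun_prop
    · filter_upwards [ae_restrict_mem measurableSet_Ioi] with r hr
      have hr : 0 < r := hr
      rw [norm_mul, norm_eq_abs, norm_of_nonneg (rpow_nonneg hr.le _), ← mul_assoc]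
      exact mul_le_mul_of_nonneg_right (hC b r le_rfl hr.le) (rpow_nonneg hr.le _)
  have hcover : AECover (volume.restrict (Set.Ioi (0 : ℝ))) (nhdsWithin 0 (Set.Ioi 0))
      (fun ε : ℝ => Set.Ioi ε) := aecover_Ioi_of_Ioi (tendsto_id.mono_left nhdsWithin_le_nhds)
  refine tendsto_nhds_unique (hcover.integral_tendsto_of_countably_generated hint) ?_
  refine (tendsto_integral_Ioi_profileSecondDiff b ha0 ha1 hA).congr' ?_
  filter_upwards [self_mem_nhdsWithin] with ε hε
  rw [Measure.restrict_restrict measurableSet_Ioi, Set.Ioi_inter_Ioi, sup_of_le_left]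
  exact le_of_lt hε

theorem integral_eq_integral_toSphere {E F : Type*} [NormedAddCommGroup E] [NormedSpace ℝ E]
    [MeasurableSpace E] [BorelSpace E] [FiniteDimensional ℝ E] [Nontrivial E]
    [NormedAddCommGroup F] [NormedSpace ℝ F]
    (μ : Measure E) [μ.IsAddHaarMeasure] {f : E → F} (hf : Integrable f μ) :
    ∫ x, f x ∂μ = ∫ θ : Metric.sphere (0 : E) 1,
      ∫ r in Set.Ioi (0 : ℝ), r ^ (Module.finrank ℝ E - 1) • f (r • (θ : E)) ∂volume
        ∂μ.toSphere := by
  have hmp := μ.measurePreserving_homeomorphUnitSphereProd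
  have hemb := (homeomorphUnitSphereProd E).measurableEmbedding
  set G : Metric.sphere (0 : E) 1 × Set.Ioi (0 : ℝ) → F := fun p => f ((p.2 : ℝ) • (p.1 : E))
    with hG
  have hcomp : (fun x : ({0}ᶜ : Set E) => f x) = G ∘ homeomorphUnitSphereProd E := by
    ext x
    have : (x : E) = (((homeomorphUnitSphereProd E x).2 : ℝ) •
        ((homeomorphUnitSphereProd E x).1 : E)) := by
      have hx : (x : E) ≠ 0 := x.2
      simp [smul_smul, hx]
    simp only [hG, Function.comp]
    rw [← this]
  have hint : Integrable G (μ.toSphere.prod (.volumeIoiPow (Module.finrank ℝ E - 1))) := by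
    rw [← hmp.integrable_comp_emb hemb, ← hcomp]
    have := hf.integrableOn (s := ({0}ᶜ : Set E))
    rwa [integrableOn_iff_comap_subtypeVal (measurableSet_singleton _).compl] at this
  calc
    ∫ x, f x ∂μ = ∫ x : ({(0)}ᶜ : Set E), f x ∂(μ.comap (↑)) := by
      rw [integral_subtype_comap (measurableSet_singleton _).compl f, restrict_compl_singleton]
    _ = ∫ p, G p ∂μ.toSphere.prod (.volumeIoiPow (Module.finrank ℝ E - 1)) := by
      rw [← hmp.integral_comp hemb, hcomp]
      rfl
    _ = ∫ θ, ∫ r, G (θ, r) ∂.volumeIoiPow (Module.finrank ℝ E - 1) ∂μ.toSphere :=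
      integral_prod _ hint
    _ = _ := by
      refine integral_congr_ae (ae_of_all _ fun θ => ?_)
      simp only [Measure.volumeIoiPow, ENNReal.ofReal]
      rw [integral_withDensity_eq_integral_smul
          ((measurable_subtype_coe.pow_const _).real_toNNReal),
        integral_subtype_comap measurableSet_Ioi fun r : ℝ =>
          Real.toNNReal (r ^ (Module.finrank ℝ E - 1)) • f (r • (θ : E))]
      refine setIntegral_congr_fun measurableSet_Ioi fun r hr => ?_
      rw [NNReal.smul_def, Real.coe_toNNReal _ (pow_nonneg (le_of_lt hr) _)]

theorem toSphere_real_univ_euclideanSpace {d : ℕ} (hd : 1 ≤ d) :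
    (volume : Measure (EuclideanSpace ℝ (Fin d))).toSphere.real Set.univ =
      2 * π ^ ((d : ℝ) / 2) / Gamma ((d : ℝ) / 2) := by
  have : Nonempty (Fin d) := ⟨⟨0, hd⟩⟩
  have hd0 : (0 : ℝ) < (d : ℝ) / 2 := by positivity
  have hG := Gamma_pos_of_pos hd0
  rw [Measure.toSphere_real_apply_univ, measureReal_def, EuclideanSpace.volume_ball]
  have h : √π ^ d = π ^ ((d : ℝ) / 2) := by
    rw [sqrt_eq_rpow, ← rpow_natCast, ← rpow_mul pi_pos.le]
    congr 1
    ring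
  simp only [finrank_euclideanSpace, Fintype.card_fin, ENNReal.ofReal_one, one_pow, one_mul]
  rw [ENNReal.toReal_ofReal (by positivity), h, Gamma_add_one hd0.ne']
  field_simp

theorem integrable_min_sq_norm_mul_rpow {d : ℕ} (hd : 1 ≤ d) {α : ℝ} (hα : α ∈ Set.Ioo (0 : ℝ) 2) :
    Integrable (fun z : EuclideanSpace ℝ (Fin d) => min 1 (‖z‖ ^ 2) * ‖z‖ ^ (-(d : ℝ) - α)) := by
  have : Nonempty (Fin d) := ⟨⟨0, hd⟩⟩
  rw [integrable_fun_norm_addHaar volume (f := fun r : ℝ => min 1 (r ^ 2) * r ^ (-(d : ℝ) - α))]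
  refine (integrableOn_Ioi_min_sq_mul_rpow (a := α / 2) (by linarith [hα.1])
    (by linarith [hα.2])).congr_fun (fun r hr => ?_) measurableSet_Ioi
  have hr : 0 < r := hr
  simp only [finrank_euclideanSpace, Fintype.card_fin, smul_eq_mul]
  rw [mul_left_comm, ← rpow_natCast r (d - 1), ← rpow_add hr, Nat.cast_sub hd]
  congr 2
  push_cast
  ring

theorem integral_profile_second_difference {d : ℕ} (hd : 1 ≤ d) {α : ℝ}
    (hα : α ∈ Set.Ioo (0 : ℝ) 2) {φα : EuclideanSpace ℝ (Fin d) → ℝ}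
    (hφα : φα = fun y => (max (1 - ‖y‖ ^ 2) 0) ^ (α / 2))
    {y : EuclideanSpace ℝ (Fin d)} (hy : ‖y‖ < 1) :
    Integrable (fun z => (2 * φα y - φα (y + z) - φα (y - z)) * ‖z‖ ^ (-(d : ℝ) - α)) ∧
    ∫ z, (2 * φα y - φα (y + z) - φα (y - z)) * ‖z‖ ^ (-(d : ℝ) - α) =
      2 * π ^ ((d : ℝ) / 2) / Gamma ((d : ℝ) / 2) * (Gamma (α / 2) * Gamma (1 - α / 2)) := by
  have : Nonempty (Fin d) := ⟨⟨0, hd⟩⟩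
  have ha0 : 0 < α / 2 := by linarith [hα.1]
  have ha1 : α / 2 < 1 := by linarith [hα.2]
  have hA : 0 < 1 - ‖y‖ ^ 2 := by nlinarith [norm_nonneg y]
  have hpolar : ∀ (θ : EuclideanSpace ℝ (Fin d)) (r : ℝ), ‖θ‖ = 1 →
      2 * φα y - φα (y + r • θ) - φα (y - r • θ) =
        profileSecondDiff (α / 2) (1 - ‖y‖ ^ 2) (inner ℝ y θ) r := by
    intro θ r hθ
    have h1 : 1 - ‖y + r • θ‖ ^ 2 = 1 - ‖y‖ ^ 2 - 2 * inner ℝ y θ * r - r ^ 2 := by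
      rw [norm_add_sq_real, inner_smul_right, norm_smul, hθ, mul_one, norm_eq_abs, sq_abs]
      ring
    have h2 : 1 - ‖y - r • θ‖ ^ 2 = 1 - ‖y‖ ^ 2 + 2 * inner ℝ y θ * r - r ^ 2 := by
      rw [norm_sub_sq_real, inner_smul_right, norm_smul, hθ, mul_one, norm_eq_abs, sq_abs]
      ring
    simp only [hφα, h1, h2, profileSecondDiff, max_eq_left hA.le]
    ring
  have hinner : ∀ θ : EuclideanSpace ℝ (Fin d), ‖θ‖ = 1 → |inner ℝ y θ| ≤ 1 := by
    intro θ hθ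
    refine (abs_real_inner_le_norm y θ).trans ?_
    rw [hθ, mul_one]
    exact hy.le
  have hφcont : Continuous φα := by
    rw [hφα]
    exact Continuous.rpow_const (by fun_prop) fun _ => Or.inr ha0.le
  have hint : Integrable
      (fun z => (2 * φα y - φα (y + z) - φα (y - z)) * ‖z‖ ^ (-(d : ℝ) - α)) := by
    obtain ⟨C, hC⟩ := exists_abs_profileSecondDiff_le_min ha0 ha1 hA zero_le_one
    refine ((integrable_min_sq_norm_mul_rpow hd hα).const_mul C).mono' ?_ (ae_of_all _ fun z => ?_)
    · have h1 : Continuous fun z => 2 * φα y - φα (y + z) - φα (y - z) := by fun_prop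
      exact (h1.measurable.mul (by fun_prop)).aestronglyMeasurable
    · rw [norm_mul, norm_of_nonneg (rpow_nonneg (norm_nonneg z) _), ← mul_assoc, norm_eq_abs]
      refine mul_le_mul_of_nonneg_right ?_ (rpow_nonneg (norm_nonneg z) _)
      rcases eq_or_ne z 0 with rfl | hz
      · simp [two_mul]
      · have hz' : ‖z‖ ≠ 0 := norm_ne_zero_iff.2 hz
        have hθ : ‖‖z‖⁻¹ • z‖ = 1 := by
          rw [norm_smul, norm_inv, norm_norm, inv_mul_cancel₀ hz']
        have h := hpolar (‖z‖⁻¹ • z) ‖z‖ hθ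
        rw [smul_inv_smul₀ hz'] at h
        rw [h]
        exact hC _ _ (hinner _ hθ) (norm_nonneg z)
  refine ⟨hint, ?_⟩
  rw [integral_eq_integral_toSphere volume hint]
  have hradial : ∀ θ : Metric.sphere (0 : EuclideanSpace ℝ (Fin d)) 1,
      ∫ r in Set.Ioi (0 : ℝ), r ^ (Module.finrank ℝ (EuclideanSpace ℝ (Fin d)) - 1) •
        ((2 * φα y - φα (y + r • (θ : EuclideanSpace ℝ (Fin d))) -
          φα (y - r • (θ : EuclideanSpace ℝ (Fin d)))) *
          ‖r • (θ : EuclideanSpace ℝ (Fin d))‖ ^ (-(d : ℝ) - α)) =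
      Gamma (α / 2) * Gamma (1 - α / 2) := by
    intro θ
    have hθ : ‖(θ : EuclideanSpace ℝ (Fin d))‖ = 1 := norm_eq_of_mem_sphere θ
    rw [← integral_Ioi_profileSecondDiff (inner ℝ y (θ : EuclideanSpace ℝ (Fin d))) ha0 ha1 hA]
    refine setIntegral_congr_fun measurableSet_Ioi fun r hr => ?_
    have hr : 0 < r := hr
    simp only [finrank_euclideanSpace, Fintype.card_fin, smul_eq_mul]
    rw [hpolar _ r hθ, norm_smul, hθ, mul_one, norm_of_nonneg hr.le, mul_left_comm,
      ← rpow_natCast r (d - 1), ← rpow_add hr, Nat.cast_sub hd]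
    congr 2
    push_cast
    ring
  simp only [hradial]
  rw [integral_const, smul_eq_mul, toSphere_real_univ_euclideanSpace hd]

theorem integrableOn_norm_rpow_of_lt_norm {d : ℕ} (hd : 1 ≤ d) {α ε : ℝ}
    (hα : α ∈ Set.Ioo (0 : ℝ) 2) (hε : 0 < ε) :
    IntegrableOn (fun z : EuclideanSpace ℝ (Fin d) => ‖z‖ ^ (-(d : ℝ) - α))
      {z | ε < ‖z‖} := by
  have hmeas : MeasurableSet {z : EuclideanSpace ℝ (Fin d) | ε < ‖z‖} :=
    measurableSet_lt measurable_const measurable_norm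
  refine (((integrable_min_sq_norm_mul_rpow hd hα).const_mul
    (min 1 (ε ^ 2))⁻¹).integrableOn).mono'
      (measurable_norm.pow_const _).aestronglyMeasurable ?_
  filter_upwards [ae_restrict_mem hmeas] with z hz
  have hz : ε < ‖z‖ := hz
  have hm : 0 < min 1 (ε ^ 2) := lt_min one_pos (by positivity)
  have hz0 : 0 ≤ ‖z‖ ^ (-(d : ℝ) - α) := rpow_nonneg (norm_nonneg z) _
  rw [norm_of_nonneg hz0, ← mul_assoc]
  refine le_mul_of_one_le_left hz0 ?_
  rw [← div_eq_inv_mul, one_le_div hm]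
  gcongr

theorem integral_norm_gt_eq_half_second_difference {d : ℕ} (hd : 1 ≤ d) {α ε : ℝ}
    (hα : α ∈ Set.Ioo (0 : ℝ) 2) (hε : 0 < ε) {φ : EuclideanSpace ℝ (Fin d) → ℝ} {K : ℝ}
    (hφ : Continuous φ) (hK : ∀ x, ‖φ x‖ ≤ K) (y : EuclideanSpace ℝ (Fin d)) :
    ∫ z in {z : EuclideanSpace ℝ (Fin d) | ε < ‖z‖}, (φ y - φ (y + z)) * ‖z‖ ^ (-(d : ℝ) - α) =
      1 / 2 * ∫ z in {z : EuclideanSpace ℝ (Fin d) | ε < ‖z‖},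
        (2 * φ y - φ (y + z) - φ (y - z)) * ‖z‖ ^ (-(d : ℝ) - α) := by
  set S : Set (EuclideanSpace ℝ (Fin d)) := {z | ε < ‖z‖} with hS
  have hmeas : MeasurableSet S := measurableSet_lt measurable_const measurable_norm
  have hint : ∀ u : EuclideanSpace ℝ (Fin d) → EuclideanSpace ℝ (Fin d), Continuous u →
      IntegrableOn (fun z => (φ y - φ (u z)) * ‖z‖ ^ (-(d : ℝ) - α)) S := by
    intro u hu
    refine Integrable.bdd_mul (c := K + K) (integrableOn_norm_rpow_of_lt_norm hd hα hε)
      (by fun_prop) (ae_of_all _ fun z => ?_)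
    exact (norm_sub_le _ _).trans (add_le_add (hK _) (hK _))
  have h1 := hint (fun z => y + z) (by fun_prop)
  have h2 := hint (fun z => y - z) (by fun_prop)
  have hsymm : ∫ z in S, (φ y - φ (y - z)) * ‖z‖ ^ (-(d : ℝ) - α) =
      ∫ z in S, (φ y - φ (y + z)) * ‖z‖ ^ (-(d : ℝ) - α) := by
    rw [← integral_indicator hmeas, ← integral_indicator hmeas, ← integral_neg_eq_self]
    refine integral_congr_ae (ae_of_all _ fun z => ?_)
    simp only [Set.indicator, hS, Set.mem_ofPred_eq, norm_neg, sub_neg_eq_add]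
  have hadd : ∫ z in S, (2 * φ y - φ (y + z) - φ (y - z)) * ‖z‖ ^ (-(d : ℝ) - α) =
      (∫ z in S, (φ y - φ (y + z)) * ‖z‖ ^ (-(d : ℝ) - α)) +
        ∫ z in S, (φ y - φ (y - z)) * ‖z‖ ^ (-(d : ℝ) - α) := by
    rw [← integral_add h1 h2]
    refine integral_congr_ae (ae_of_all _ fun z => ?_)
    ring
  rw [hadd, hsymm]
  ring

theorem getoor_fractional_laplacian_of_profile
    (d : ℕ) (hd : 1 ≤ d) (α : ℝ) (hα : α ∈ Set.Ioo (0 : ℝ) 2)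
    (φα : EuclideanSpace ℝ (Fin d) → ℝ)
    (hφα : φα = fun y => (max (1 - ‖y‖ ^ 2) 0) ^ (α / 2))
    (c : ℝ)
    (hc : c = 2 ^ α * Real.Gamma (((d : ℝ) + α) / 2) /
        (Real.pi ^ ((d : ℝ) / 2) * |Real.Gamma (-α / 2)|))
    (y : EuclideanSpace ℝ (Fin d)) (hy : ‖y‖ < 1) :
    ∃ L : ℝ,
      Tendsto
        (fun ε : ℝ =>
          ∫ z in {z : EuclideanSpace ℝ (Fin d) | ε < ‖z‖},
            (φα y - φα (y + z)) * ‖z‖ ^ (-(d : ℝ) - α))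
        (nhdsWithin 0 (Set.Ioi 0)) (nhds L) ∧
      c * L =
        2 ^ α * Real.Gamma (1 + α / 2) * Real.Gamma (((d : ℝ) + α) / 2) /
          Real.Gamma ((d : ℝ) / 2) := by
  have : Nonempty (Fin d) := ⟨⟨0, hd⟩⟩
  have ha0 : 0 < α / 2 := by linarith [hα.1]
  have ha1 : α / 2 < 1 := by linarith [hα.2]
  have hφcont : Continuous φα := by
    rw [hφα]
    exact Continuous.rpow_const (by fun_prop) fun _ => Or.inr ha0.le
  have hφbd : ∀ x, ‖φα x‖ ≤ 1 := by
    intro x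
    have h0 : 0 ≤ max (1 - ‖x‖ ^ 2) 0 := le_max_right _ _
    simp only [hφα]
    rw [norm_of_nonneg (rpow_nonneg h0 _)]
    exact rpow_le_one h0 (max_le (by nlinarith [sq_nonneg ‖x‖]) zero_le_one) ha0.le
  obtain ⟨hint, hval⟩ := integral_profile_second_difference hd hα hφα hy
  have hcover : AECover (volume : Measure (EuclideanSpace ℝ (Fin d))) (nhdsWithin 0 (Set.Ioi 0))
      (fun ε : ℝ => {z : EuclideanSpace ℝ (Fin d) | ε < ‖z‖}) := by
    refine ⟨?_, fun ε => measurableSet_lt measurable_const measurable_norm⟩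
    filter_upwards [Measure.ae_ne volume (0 : EuclideanSpace ℝ (Fin d))] with z hz
    exact (eventually_lt_nhds (norm_pos_iff.2 hz)).filter_mono nhdsWithin_le_nhds
  have hlim := (hcover.integral_tendsto_of_countably_generated hint).const_mul (1 / 2)
  rw [hval] at hlim
  refine ⟨_, hlim.congr' ?_, ?_⟩
  · filter_upwards [self_mem_nhdsWithin] with ε hε
    exact (integral_norm_gt_eq_half_second_difference hd hα hε hφcont hφbd y).symm
  · have hG1 : Gamma (1 + α / 2) = α / 2 * Gamma (α / 2) := by
      rw [add_comm, Gamma_add_one ha0.ne']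
    have hG2 : Gamma (1 - α / 2) = α / 2 * |Gamma (-α / 2)| := by
      have h := Gamma_add_one (s := -α / 2) (by linarith)
      have hpos : 0 < Gamma (1 - α / 2) := Gamma_pos_of_pos (by linarith)
      rw [show -α / 2 + 1 = 1 - α / 2 by ring] at h
      rw [← abs_of_pos hpos, h, abs_mul, show -α / 2 = -(α / 2) by ring, abs_neg,
        abs_of_pos ha0]
    have hG3 : |Gamma (-α / 2)| ≠ 0 := by
      have hpos : 0 < Gamma (1 - α / 2) := Gamma_pos_of_pos (by linarith)
      intro h
      rw [hG2, h, mul_zero] at hpos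
      exact lt_irrefl _ hpos
    have hGd : Gamma ((d : ℝ) / 2) ≠ 0 := (Gamma_pos_of_pos (by positivity)).ne'
    have hpi : π ^ ((d : ℝ) / 2) ≠ 0 := (rpow_pos_of_pos pi_pos _).ne'
    rw [hc, hG1, hG2]
    generalize |Gamma (-α / 2)| = G at hG3 ⊢
    field_simp
end
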